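/- Let n ≥ 2 and let A be an n-qubit architecture with R = T·L gates that is the concatenation of T consecutive causal slices of L gates each, where T ≤ 2^{n+1} − 2. Then for μ-almost every x ∈ SU(4)^{×R}, the exact state complexity of the produced state satisfies C_state(F^A(x)|0^n⟩) ≥ R/(9L) − n/3. -/

import Mathlib

open scoped Matrix ENNReal Classical Kronecker ComplexOrder
open MeasureTheory

/-! ## Basic objects: qubit bases, gates, architectures, contraction maps -/

/-- Computational-basis index set for `n` qubits. -/
abbrev QubitBasis (n : ℕ) := Fin n → Fin 2

/-- `2^n × 2^n` complex matrices, indexed by the computational basis of `n` qubits. -/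
abbrev NMatrix (n : ℕ) := Matrix (QubitBasis n) (QubitBasis n) ℂ

/-- The special unitary group `SU(4)` of two-qubit gates. -/
abbrev SU4 := Matrix.specialUnitaryGroup (Fin 4) ℂ

/-- An architecture on `n` qubits with `R` gates: a list of ordered pairs of distinct qubits. -/
def Architecture (n R : ℕ) := Fin R → {p : Fin n × Fin n // p.1 ≠ p.2}

/-- Identification of a pair of one-qubit basis indices with a two-qubit basis index. -/
def pairIdx (a b : Fin 2) : Fin 4 := ⟨2 * a.val + b.val, by omega⟩

/-- The `n`-qubit matrix given by letting the two-qubit matrix `u` act on the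
tensor factors `p.1` and `p.2`, and as the identity on all other factors. -/
noncomputable def embedGate {n : ℕ} (p : Fin n × Fin n) (u : Matrix (Fin 4) (Fin 4) ℂ) :
    NMatrix n := fun a b =>
  if (∀ i, i ≠ p.1 → i ≠ p.2 → a i = b i)
  then u (pairIdx (a p.1) (a p.2)) (pairIdx (b p.1) (b p.2)) else 0

/-- The list of `n`-qubit gates obtained by substituting the gates `x` into
the architecture `A`. -/
noncomputable def gateList {n R : ℕ} (A : Architecture n R) (x : Fin R → SU4) :
    List (NMatrix n) :=
  List.ofFn fun i => embedGate (A i).1 (x i : Matrix (Fin 4) (Fin 4) ℂ)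

/-- The contraction map `F^A` of an architecture `A`: it sends a tuple of two-qubit gates
`(u_1, …, u_R)` to the `n`-qubit unitary `(u_R)_{p_R} ⋯ (u_1)_{p_1}`. -/
noncomputable def contract {n R : ℕ} (A : Architecture n R) (x : Fin R → SU4) : NMatrix n :=
  ((gateList A x).reverse).prod

/-- The exact circuit complexity: the least number `R` of two-qubit gates, arranged in any
architecture, implementing the matrix `U`. -/
noncomputable def Cu (n : ℕ) (U : NMatrix n) : ℕ :=
  sInf {R | ∃ A : Architecture n R, ∃ x : Fin R → SU4, contract A x = U}

/-- The all-zeros computational basis state `|0^n⟩`. -/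
noncomputable def ket0 (n : ℕ) : QubitBasis n → ℂ := fun a => if a = fun _ => 0 then 1 else 0

/-- The exact state complexity: the least number `R` of two-qubit gates, arranged in any
architecture, producing `ψ` from `|0^n⟩`. -/
noncomputable def Cstate (n : ℕ) (ψ : QubitBasis n → ℂ) : ℕ :=
  sInf {R | ∃ A : Architecture n R, ∃ x : Fin R → SU4, (contract A x) *ᵥ ket0 n = ψ}

/-- The gates with indices `lo ≤ i < hi` of `A` form a causal slice with sink qubit `t`:
every qubit `q` is connected to `t` by a path through gates of the slice, taken in
increasing index order. -/
def IsCausalSliceWith {n R : ℕ} (A : Architecture n R) (lo hi : ℕ) (t : Fin n) : Prop :=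
  ∀ q : Fin n, ∃ (m : ℕ) (idx : Fin m → Fin R) (qs : Fin (m + 1) → Fin n),
    StrictMono idx ∧ (∀ l, lo ≤ (idx l : ℕ) ∧ (idx l : ℕ) < hi) ∧
    qs 0 = q ∧ qs (Fin.last m) = t ∧
    ∀ l : Fin m,
      (qs l.castSucc = (A (idx l)).1.1 ∨ qs l.castSucc = (A (idx l)).1.2) ∧
      (qs l.succ = (A (idx l)).1.1 ∨ qs l.succ = (A (idx l)).1.2)

/-- The gates with indices `lo ≤ i < hi` of `A` form a causal slice. -/
def IsCausalSlice {n R : ℕ} (A : Architecture n R) (lo hi : ℕ) : Prop :=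
  ∃ t, IsCausalSliceWith A lo hi t

/-! ## Group, topological, measurable and compactness structure on `SU(4)`,
and its Haar probability measure -/

namespace SU4

theorem star_mem {U : Matrix (Fin 4) (Fin 4) ℂ}
    (hU : U ∈ Matrix.specialUnitaryGroup (Fin 4) ℂ) :
    star U ∈ Matrix.specialUnitaryGroup (Fin 4) ℂ := by
  rw [Matrix.mem_specialUnitaryGroup_iff] at hU ⊢
  refine ⟨Unitary.star_mem hU.1, ?_⟩
  have : (star U).det = star U.det := by
    simp [Matrix.star_eq_conjTranspose, Matrix.det_conjTranspose]
  rw [this, hU.2]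
  simp

noncomputable instance : Group SU4 :=
  { (inferInstance : Monoid SU4) with
    inv := fun U => ⟨star U.1, star_mem U.2⟩
    inv_mul_cancel := fun U => Subtype.ext <| by
      have h := (Matrix.mem_specialUnitaryGroup_iff.mp U.2).1.1
      simpa using h }

instance : IsTopologicalGroup SU4 where
  continuous_mul := by
    apply Continuous.subtype_mk
    exact ((continuous_subtype_val.comp continuous_fst).matrix_mul
      (continuous_subtype_val.comp continuous_snd))
  continuous_inv := by
    apply Continuous.subtype_mk
    exact continuous_star.comp continuous_subtype_val

noncomputable instance : MeasurableSpace (Matrix (Fin 4) (Fin 4) ℂ) :=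
  inferInstanceAs (MeasurableSpace (Fin 4 → Fin 4 → ℂ))

instance : BorelSpace (Matrix (Fin 4) (Fin 4) ℂ) :=
  inferInstanceAs (BorelSpace (Fin 4 → Fin 4 → ℂ))

theorem isClosed :
    IsClosed (Matrix.specialUnitaryGroup (Fin 4) ℂ : Set (Matrix (Fin 4) (Fin 4) ℂ)) := by
  have h1 : IsClosed {M : Matrix (Fin 4) (Fin 4) ℂ | star M * M = 1} :=
    isClosed_eq ((continuous_id.matrix_conjTranspose).matrix_mul continuous_id) continuous_const
  have h2 : IsClosed {M : Matrix (Fin 4) (Fin 4) ℂ | M * star M = 1} :=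
    isClosed_eq (continuous_id.matrix_mul (continuous_id.matrix_conjTranspose)) continuous_const
  have h3 : IsClosed {M : Matrix (Fin 4) (Fin 4) ℂ | M.det = 1} :=
    isClosed_eq continuous_id.matrix_det continuous_const
  have : (Matrix.specialUnitaryGroup (Fin 4) ℂ : Set (Matrix (Fin 4) (Fin 4) ℂ)) =
      ({M | star M * M = 1} ∩ {M | M * star M = 1}) ∩ {M | M.det = 1} := by
    ext M
    simp only [SetLike.mem_coe, Matrix.mem_specialUnitaryGroup_iff, Unitary.mem_iff,
      Set.mem_inter_iff, Set.mem_setOf_eq]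
  rw [this]
  exact ((h1.inter h2)).inter h3

theorem isCompact :
    IsCompact (Matrix.specialUnitaryGroup (Fin 4) ℂ : Set (Matrix (Fin 4) (Fin 4) ℂ)) := by
  have hK : IsCompact (Set.pi Set.univ fun _ : Fin 4 => Set.pi Set.univ fun _ : Fin 4 =>
      Metric.closedBall (0 : ℂ) 1 : Set (Matrix (Fin 4) (Fin 4) ℂ)) :=
    isCompact_univ_pi fun _ => isCompact_univ_pi fun _ => isCompact_closedBall _ _
  refine IsCompact.of_isClosed_subset hK isClosed ?_
  intro M hM
  refine fun i _ => fun j _ => ?_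
  simp only [Metric.mem_closedBall, dist_zero_right]
  exact entry_norm_bound_of_unitary (Matrix.mem_specialUnitaryGroup_iff.mp hM).1 i j

instance : CompactSpace SU4 :=
  isCompact_iff_compactSpace.mp isCompact

noncomputable instance : MeasurableSpace SU4 := borel SU4

instance : BorelSpace SU4 := ⟨rfl⟩

end SU4

/-- The Haar probability measure on `SU(4)`. -/
noncomputable def haarSU4 : Measure SU4 :=
  Measure.haarMeasure ⟨⟨Set.univ, isCompact_univ⟩, by simp⟩

instance : IsProbabilityMeasure haarSU4 := by
  constructor
  have h : Measure.haarMeasure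
      (⟨⟨Set.univ, isCompact_univ⟩, by simp⟩ : TopologicalSpace.PositiveCompacts SU4)
      (⟨⟨Set.univ, isCompact_univ⟩, by simp⟩ : TopologicalSpace.PositiveCompacts SU4) = 1 :=
    Measure.haarMeasure_self
  simpa [haarSU4] using h

/-- The product of Haar probability measures on `SU(4)^{×R}`: the distribution of a random
quantum circuit with `R` gates in a fixed architecture. -/
noncomputable def muSU4 (R : ℕ) : Measure (Fin R → SU4) :=
  Measure.pi fun _ => haarSU4

/-! ## The differential of the contraction map, its rank, and the accessible dimension -/

/-- The Lie algebra `su(m)` of traceless skew-Hermitian matrices, as a real subspace. -/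
noncomputable def suAlgebra (m : Type*) [Fintype m] [DecidableEq m] :
    Submodule ℝ (Matrix m m ℂ) :=
  Submodule.span ℝ {H | Hᴴ = -H ∧ H.trace = 0}

/-- `embedGate` as a real-linear map in the gate entry. -/
noncomputable def embedLin {n : ℕ} (p : Fin n × Fin n) :
    Matrix (Fin 4) (Fin 4) ℂ →ₗ[ℝ] NMatrix n where
  toFun := embedGate p
  map_add' u v := by
    funext a b
    simp only [embedGate, Matrix.add_apply]
    split <;> simp
  map_smul' r u := by
    funext a b
    simp only [embedGate, Matrix.smul_apply, RingHom.id_apply]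
    split <;> simp

/-- The differential of the contraction map `F^A` at the point `x ∈ SU(4)^{×R}`, read in the
exponential charts: the direction `(H_1, …, H_R)` is mapped to
`∑_j (U_R)_{p_R} ⋯ (U_{j+1})_{p_{j+1}} · (H_j)_{p_j} · (U_j)_{p_j} ⋯ (U_1)_{p_1}`. -/
noncomputable def contractDiff {n R : ℕ} (A : Architecture n R) (x : Fin R → SU4) :
    (Fin R → Matrix (Fin 4) (Fin 4) ℂ) →ₗ[ℝ] NMatrix n :=
  ∑ j : Fin R,
    (LinearMap.mulLeft ℝ (((gateList A x).drop (j + 1)).reverse.prod)) ∘ₗ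
      (LinearMap.mulRight ℝ
        (embedGate (A j).1 (x j : Matrix (Fin 4) (Fin 4) ℂ) *
          ((gateList A x).take j).reverse.prod)) ∘ₗ
      (embedLin (A j).1) ∘ₗ
      (LinearMap.proj j)

/-- The rank of (the differential of) the contraction map `F^A` at `x`: the dimension of
the image, under the differential, of the tangent space `su(4)^{×R}`. -/
noncomputable def rankAt {n R : ℕ} (A : Architecture n R) (x : Fin R → SU4) : ℕ :=
  Module.finrank ℝ
    ↥(Submodule.map (contractDiff A x) (Submodule.pi Set.univ fun _ => suAlgebra (Fin 4)))

/-- The maximal rank `r_max` of the contraction map `F^A` over all points of `SU(4)^{×R}`. -/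
noncomputable def rmax {n R : ℕ} (A : Architecture n R) : ℕ := ⨆ x, rankAt A x

/-- A matrix viewed as a point of the Euclidean (Frobenius) space of its entries. -/
noncomputable def toEuc {n : ℕ} (M : NMatrix n) :
    EuclideanSpace ℂ (QubitBasis n × QubitBasis n) :=
  WithLp.toLp 2 fun p => M p.1 p.2

/-- The Frobenius norm `‖X‖_F = (tr (X† X))^{1/2}` of an `n`-qubit matrix. -/
noncomputable def frobNorm {n : ℕ} (M : NMatrix n) : ℝ := ‖toEuc M‖

/-- The accessible dimension `d_A` of an architecture `A`: the Hausdorff dimension of the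
set `U(A)` of unitaries implementable with `A`, with respect to the Frobenius metric. -/
noncomputable def accessibleDim {n R : ℕ} (A : Architecture n R) : ℝ≥0∞ :=
  dimH (toEuc '' Set.range (contract A))

/-! ## Pauli strings and Clifford gates -/

/-- The Pauli matrices `1, X, Y, Z`. -/
noncomputable def pauli : Fin 4 → Matrix (Fin 2) (Fin 2) ℂ
  | 0 => 1
  | 1 => !![0, 1; 1, 0]
  | 2 => !![0, -Complex.I; Complex.I, 0]
  | 3 => !![1, 0; 0, -1]

/-- The `n`-qubit Pauli string `⨂ᵢ pauli (s i)`. -/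
noncomputable def pauliString {n : ℕ} (s : Fin n → Fin 4) : NMatrix n :=
  fun a b => ∏ i, pauli (s i) (a i) (b i)

/-- A two-qubit Pauli string, as a `4 × 4` matrix. -/
noncomputable def pauli2 (s : Fin 2 → Fin 4) : Matrix (Fin 4) (Fin 4) ℂ :=
  fun a b =>
    pauli (s 0) ⟨a.val / 2, by have := a.isLt; omega⟩ ⟨b.val / 2, by have := b.isLt; omega⟩ *
    pauli (s 1) ⟨a.val % 2, by have := a.isLt; omega⟩ ⟨b.val % 2, by have := b.isLt; omega⟩

/-- A two-qubit gate is Clifford if it maps every Pauli string to a scalar multiple of a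
Pauli string under conjugation. -/
def IsCliffordGate (u : Matrix (Fin 4) (Fin 4) ℂ) : Prop :=
  ∀ s : Fin 2 → Fin 4, ∃ (c : ℂ) (s' : Fin 2 → Fin 4),
    u * pauli2 s * uᴴ = c • pauli2 s'

/-- Application to the state `|0^n⟩`, `M ↦ M |0^n⟩`, as a real-linear map. -/
noncomputable def mulVecKet0 (n : ℕ) : NMatrix n →ₗ[ℝ] (QubitBasis n → ℂ) where
  toFun M := M *ᵥ ket0 n
  map_add' M N := Matrix.add_mulVec M N (ket0 n)
  map_smul' r M := by
    simp only [RingHom.id_apply]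
    exact Matrix.smul_mulVec r M (ket0 n)

/-- The rank of (the differential of) the map `G^A : x ↦ F^A(x)|0^n⟩` at `x`. -/
noncomputable def stateRankAt {n R : ℕ} (A : Architecture n R) (x : Fin R → SU4) : ℕ :=
  Module.finrank ℝ
    ↥(Submodule.map ((mulVecKet0 n) ∘ₗ contractDiff A x)
      (Submodule.pi Set.univ fun _ => suAlgebra (Fin 4)))

/-! ## Trace norm and operator norm -/

/-- The positive semidefinite square root of a positive semidefinite matrix
(formerly in Mathlib under this name, with this definition). -/
noncomputable def Matrix.PosSemidef.sqrt {m 𝕜 : Type*} [Fintype m] [RCLike 𝕜] [DecidableEq m]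
    {A : Matrix m m 𝕜} (hA : A.PosSemidef) : Matrix m m 𝕜 :=
  hA.1.eigenvectorUnitary.1 * Matrix.diagonal (RCLike.ofReal ∘ Real.sqrt ∘ hA.1.eigenvalues) *
    (star hA.1.eigenvectorUnitary : Matrix m m 𝕜)

/-- The trace norm `‖M‖₁ = tr ((M† M)^{1/2})` of a square complex matrix. -/
noncomputable def traceNorm {m : Type*} [Fintype m] [DecidableEq m] (M : Matrix m m ℂ) : ℝ :=
  ((Matrix.posSemidef_conjTranspose_mul_self M).sqrt.trace).re

/-- The operator norm (largest singular value) of a square complex matrix: the norm of the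
induced operator between Euclidean spaces. -/
noncomputable def opNorm {m : Type*} [Fintype m] [DecidableEq m] (M : Matrix m m ℂ) : ℝ :=
  ‖LinearMap.toContinuousLinearMap (Matrix.toEuclideanLin M)‖

/-! ## The uniform measure on a finite index set -/

/-- The uniform probability measure on `Fin m`. -/
noncomputable def uniformFin (m : ℕ) : Measure (Fin m) :=
  ((m : ℝ≥0∞))⁻¹ • Measure.count

instance (m : ℕ) : IsFiniteMeasure (uniformFin m) := by
  constructor
  rw [uniformFin, Measure.smul_apply, smul_eq_mul, Measure.count_univ,
    ENat.card_eq_coe_fintype_card, Fintype.card_fin, ENat.toENNReal_coe]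
  rcases Nat.eq_zero_or_pos m with h | h
  · simp [h]
  · rw [ENNReal.inv_mul_cancel (by exact_mod_cast h.ne') (by simp)]
    exact ENNReal.one_lt_top

/-! ## Statement 1: linear growth of exact state complexity for random quantum circuits -/

namespace LG

section alg
variable {ι : Type}

/-- vanishing on a set of points -/
def Van (S : Set (ι → ℂ)) (f : MvPolynomial ι ℂ) : Prop := ∀ z ∈ S, MvPolynomial.eval z f = 0

/-- irreducibility -/
def Irr (S : Set (ι → ℂ)) : Prop :=
  ∀ f g : MvPolynomial ι ℂ, Van S (f * g) → Van S f ∨ Van S g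

/-- `k` independent functions on `S` -/
def Ind (S : Set (ι → ℂ)) (k : ℕ) : Prop :=
  ∃ q : Fin k → MvPolynomial ι ℂ, ∀ F : MvPolynomial (Fin k) ℂ, F ≠ 0 →
    ∃ z ∈ S, MvPolynomial.eval (fun i => MvPolynomial.eval z (q i)) F ≠ 0

theorem eval_aev {κ : Type} (z : ι → ℂ) (q : κ → MvPolynomial ι ℂ) (F : MvPolynomial κ ℂ) :
    MvPolynomial.eval z (MvPolynomial.aeval q F) =
      MvPolynomial.eval (fun i => MvPolynomial.eval z (q i)) F := by
  induction F using MvPolynomial.induction_on with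
  | C a => simp
  | add p q hp hq => rw [map_add, map_add, hp, hq, map_add]
  | mul_X p i hp => rw [map_mul, map_mul, hp, map_mul, MvPolynomial.aeval_X, MvPolynomial.eval_X]

theorem ind_zero {S : Set (ι → ℂ)} (h : S.Nonempty) : Ind S 0 := by
  obtain ⟨z, hz⟩ := h
  refine ⟨Fin.elim0, fun F hF => ⟨z, hz, ?_⟩⟩
  rw [MvPolynomial.eq_C_of_isEmpty F] at hF ⊢
  simpa using hF

theorem ind_step {S S' : Set (ι → ℂ)} (hSS : S ⊆ S') (hI : Irr S')
    (f : MvPolynomial ι ℂ) (hf : Van S f) (hf' : ¬ Van S' f) {k : ℕ} (h : Ind S k) :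
    Ind S' (k + 1) := by
  obtain ⟨q, hq⟩ := h
  have key : ∀ (N : ℕ) (G : Polynomial (MvPolynomial (Fin k) ℂ)), G.natDegree ≤ N → G ≠ 0 →
      ¬ Van S' (Polynomial.eval f (G.map (MvPolynomial.aeval q : _ →ₐ[ℂ] _).toRingHom)) := by
    intro N
    induction N with
    | zero =>
      intro G hN hG hV
      have h0 : G.coeff 0 ≠ 0 := by
        intro h0
        apply hG
        rw [Polynomial.eq_C_of_natDegree_le_zero hN, h0, map_zero]
      obtain ⟨z, hz, hz'⟩ := hq _ h0
      apply hz'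
      have := hV z (hSS hz)
      rw [Polynomial.eq_C_of_natDegree_le_zero hN] at this
      simp only [Polynomial.map_C, Polynomial.eval_C] at this
      rw [← this]
      exact (eval_aev z q _).symm
    | succ N ih =>
      intro G hN hG hV
      by_cases h0 : G.coeff 0 = 0
      · have hG' : G = G.divX * Polynomial.X := by
          conv_lhs => rw [← Polynomial.divX_mul_X_add G, h0]
          simp
        have hd : G.divX ≠ 0 := by
          intro h; rw [h, zero_mul] at hG'; exact hG hG'
        have hn : G.divX.natDegree ≤ N := by
          rw [Polynomial.natDegree_divX_eq_natDegree_tsub_one]; omega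
        rw [hG'] at hV
        simp only [Polynomial.map_mul, Polynomial.map_X, Polynomial.eval_mul, Polynomial.eval_X] at hV
        rcases hI _ _ hV with h | h
        · exact ih _ hn hd h
        · exact hf' h
      · obtain ⟨z, hz, hz'⟩ := hq _ h0
        apply hz'
        have := hV z (hSS hz)
        have hfz := hf z hz
        rw [← Polynomial.divX_mul_X_add G] at this
        simp only [Polynomial.map_add, Polynomial.map_mul, Polynomial.map_X, Polynomial.eval_add,
          Polynomial.eval_mul, Polynomial.eval_X, map_add, map_mul, hfz, mul_zero, zero_add,
          Polynomial.map_C, Polynomial.eval_C] at this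
        rw [← this]
        exact (eval_aev z q _).symm
  refine ⟨Fin.cons f q, fun F hF => ?_⟩
  by_contra hcon
  push Not at hcon
  apply key _ (MvPolynomial.finSuccEquiv ℂ k F) le_rfl (by simpa using hF)
  intro z hz
  have h1 := hcon z hz
  have h2 : (fun i => MvPolynomial.eval z ((Fin.cons f q : Fin (k+1) → MvPolynomial ι ℂ) i)) =
      Fin.cons (MvPolynomial.eval z f) (fun i => MvPolynomial.eval z (q i)) := by
    funext i; refine Fin.cases ?_ (fun j => ?_) i <;> simp
  rw [h2, MvPolynomial.eval_eq_eval_mv_eval'] at h1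
  rw [← h1, ← Polynomial.eval_map_apply, Polynomial.map_map]
  congr 2
  apply MvPolynomial.ringHom_ext
  · intro r; simp
  · intro i; simp

theorem ind_full [Fintype ι] {S : Set (ι → ℂ)} (h : ∀ f, Van S f → f = 0) {k : ℕ}
    (hk : k ≤ Fintype.card ι) : Ind S k := by
  have : Nonempty (Fin k ↪ ι) := by
    apply Function.Embedding.nonempty_of_card_le
    simpa using hk
  obtain ⟨e⟩ := this
  refine ⟨fun i => MvPolynomial.X (e i), fun F hF => ?_⟩
  by_contra hcon
  push Not at hcon
  apply hF
  apply MvPolynomial.rename_injective e e.injective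
  rw [map_zero]
  apply h
  intro z hz
  have := hcon z hz
  rw [MvPolynomial.eval_rename]
  simpa [Function.comp_def] using this

theorem ind_bound {σ : Type} [Fintype σ] {S : Set (ι → ℂ)} {k : ℕ} (h : Ind S k)
    (Φ : ι → MvPolynomial σ ℂ)
    (hΦ : ∀ f : MvPolynomial ι ℂ,
      (∀ t : σ → ℂ, MvPolynomial.eval (fun i => MvPolynomial.eval t (Φ i)) f = 0) → Van S f) :
    k ≤ Fintype.card σ := by
  obtain ⟨q, hq⟩ := h
  have hind : AlgebraicIndependent ℂ (fun j => MvPolynomial.aeval Φ (q j)) := by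
    rw [algebraicIndependent_iff]
    intro F hF
    by_contra hne
    obtain ⟨z, hz, hz'⟩ := hq F hne
    apply hz'
    have hV : Van S (MvPolynomial.aeval q F) := by
      apply hΦ
      intro t
      have h2 : (MvPolynomial.eval fun i => MvPolynomial.eval t (Φ i)) =
          (MvPolynomial.eval t).comp (MvPolynomial.aeval Φ : _ →ₐ[ℂ] _).toRingHom := by
        apply MvPolynomial.ringHom_ext
        · intro r; simp
        · intro i; simp
      rw [h2]
      have h3 : ((MvPolynomial.aeval Φ).comp (MvPolynomial.aeval q)) F = 0 := by
        rw [← hF, MvPolynomial.comp_aeval]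
      simp only [RingHom.comp_apply]
      have h4 : (MvPolynomial.aeval Φ : _ →ₐ[ℂ] _).toRingHom (MvPolynomial.aeval q F) = 0 := h3
      rw [h4, map_zero]
    have := hV z hz
    rw [← this]
    exact (eval_aev z q _).symm
  have := hind.lift_cardinalMk_le_trdeg
  rw [MvPolynomial.trdeg_of_isDomain] at this
  simpa using this

end alg
end LG

namespace LG

section polyfun
variable {T : Type} (𝒜 : Subalgebra ℂ (T → ℂ))

theorem mem_const (c : ℂ) : (fun _ : T => c) ∈ 𝒜 := 𝒜.algebraMap_mem c

theorem mem_sum {κ : Type*} (s : Finset κ) (F : κ → T → ℂ) (h : ∀ i ∈ s, F i ∈ 𝒜) :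
    (fun t => ∑ i ∈ s, F i t) ∈ 𝒜 := by
  have := 𝒜.sum_mem h
  convert this using 1
  funext t; simp

theorem mem_prod {κ : Type*} (s : Finset κ) (F : κ → T → ℂ) (h : ∀ i ∈ s, F i ∈ 𝒜) :
    (fun t => ∏ i ∈ s, F i t) ∈ 𝒜 := by
  have := 𝒜.prod_mem h
  convert this using 1
  funext t; simp

theorem mem_mul {F G : T → ℂ} (hF : F ∈ 𝒜) (hG : G ∈ 𝒜) : (fun t => F t * G t) ∈ 𝒜 :=
  𝒜.mul_mem hF hG

theorem mem_add {F G : T → ℂ} (hF : F ∈ 𝒜) (hG : G ∈ 𝒜) : (fun t => F t + G t) ∈ 𝒜 :=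
  𝒜.add_mem hF hG

theorem mem_sub {F G : T → ℂ} (hF : F ∈ 𝒜) (hG : G ∈ 𝒜) : (fun t => F t - G t) ∈ 𝒜 :=
  𝒜.sub_mem hF hG

theorem mem_det {m : Type} [Fintype m] [DecidableEq m] (M : T → Matrix m m ℂ)
    (h : ∀ i j, (fun t => M t i j) ∈ 𝒜) : (fun t => (M t).det) ∈ 𝒜 := by
  simp only [Matrix.det_apply]
  refine mem_sum 𝒜 _ _ fun s _ => ?_
  have : (fun t => Equiv.Perm.sign s • ∏ i, M t (s i) i) =
      fun t => ((Equiv.Perm.sign s : ℤ) : ℂ) * ∏ i, M t (s i) i := by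
    funext t
    rw [Units.smul_def, zsmul_eq_mul]
  rw [this]
  exact mem_mul 𝒜 (mem_const 𝒜 _) (mem_prod 𝒜 _ _ fun i _ => h _ _)

theorem mem_adj {m : Type} [Fintype m] [DecidableEq m] (M : T → Matrix m m ℂ)
    (h : ∀ i j, (fun t => M t i j) ∈ 𝒜) (i j : m) : (fun t => (M t).adjugate i j) ∈ 𝒜 := by
  simp only [Matrix.adjugate_apply]
  refine mem_det 𝒜 _ fun a b => ?_
  by_cases hab : a = j
  · subst hab
    simp only [Matrix.updateRow_self]
    exact mem_const 𝒜 _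
  · simp only [Matrix.updateRow_ne hab]
    exact h a b

theorem mem_matmul {l m o : Type} [Fintype m] (M : T → Matrix l m ℂ) (N : T → Matrix m o ℂ)
    (h : ∀ i j, (fun t => M t i j) ∈ 𝒜) (h' : ∀ i j, (fun t => N t i j) ∈ 𝒜) (i : l) (j : o) :
    (fun t => (M t * N t) i j) ∈ 𝒜 := by
  simp only [Matrix.mul_apply]
  exact mem_sum 𝒜 _ _ fun k _ => mem_mul 𝒜 (h _ _) (h' _ _)

theorem mem_mulVec {l m : Type} [Fintype m] (M : T → Matrix l m ℂ) (v : T → m → ℂ)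
    (h : ∀ i j, (fun t => M t i j) ∈ 𝒜) (h' : ∀ i, (fun t => v t i) ∈ 𝒜) (i : l) :
    (fun t => (M t *ᵥ v t) i) ∈ 𝒜 := by
  simp only [Matrix.mulVec, dotProduct]
  exact mem_sum 𝒜 _ _ fun k _ => mem_mul 𝒜 (h _ _) (h' _)

theorem mem_eval {ι : Type} (f : MvPolynomial ι ℂ) (z : T → ι → ℂ)
    (h : ∀ i, (fun t => z t i) ∈ 𝒜) : (fun t => MvPolynomial.eval (z t) f) ∈ 𝒜 := by
  induction f using MvPolynomial.induction_on with
  | C a => simpa using mem_const 𝒜 a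
  | add p q hp hq => simpa using mem_add 𝒜 hp hq
  | mul_X p i hp => simpa using mem_mul 𝒜 hp (h i)

/-- polynomial functions of one variable -/
noncomputable def PolyC : Subalgebra ℂ (ℂ → ℂ) :=
  (Polynomial.aeval (id : ℂ → ℂ) : Polynomial ℂ →ₐ[ℂ] (ℂ → ℂ)).range

theorem polyC_iff {F : ℂ → ℂ} (h : F ∈ PolyC) : ∃ p : Polynomial ℂ, ∀ t, F t = p.eval t := by
  obtain ⟨p, rfl⟩ := h
  refine ⟨p, fun t => ?_⟩
  have := Polynomial.aeval_algHom_apply (Pi.evalAlgHom ℂ (fun _ : ℂ => ℂ) t) (id : ℂ → ℂ) p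
  simp only [Pi.evalAlgHom_apply, id] at this
  rw [Polynomial.coe_aeval_eq_eval] at this
  exact this.symm

theorem polyC_id : (fun t : ℂ => t) ∈ PolyC := ⟨Polynomial.X, by simp; rfl⟩

theorem polyC_finite {F : ℂ → ℂ} (h : F ∈ PolyC) (t₀ : ℂ) (h0 : F t₀ ≠ 0) :
    {t | F t = 0}.Finite := by
  obtain ⟨p, hp⟩ := polyC_iff h
  have : p ≠ 0 := by
    rintro rfl; simp [hp] at h0
  refine (Polynomial.finite_setOf_isRoot this).subset fun t ht => ?_
  simpa [hp] using ht

theorem polyC_both {F G : ℂ → ℂ} (hF : F ∈ PolyC) (hG : G ∈ PolyC) (t₁ t₂ : ℂ) (h1 : F t₁ ≠ 0)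
    (h2 : G t₂ ≠ 0) : ∃ t, F t ≠ 0 ∧ G t ≠ 0 := by
  have := ((polyC_finite hF t₁ h1).union (polyC_finite hG t₂ h2)).infinite_compl
  obtain ⟨t, ht⟩ := this.nonempty
  refine ⟨t, ?_⟩
  simpa [not_or] using ht

theorem polyC_zero_of_infinite {F : ℂ → ℂ} (hF : F ∈ PolyC) (s : Set ℂ) (hs : s.Infinite)
    (h : ∀ t ∈ s, F t = 0) (t : ℂ) : F t = 0 := by
  by_contra ht
  exact hs ((polyC_finite hF t ht).subset h)

/-- if `F * G` vanishes and `G` is not identically zero, `F` vanishes -/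
theorem polyC_cancel {F G : ℂ → ℂ} (hF : F ∈ PolyC) (hG : G ∈ PolyC) (t₂ : ℂ)
    (h2 : G t₂ ≠ 0) (h : ∀ t, G t ≠ 0 → F t = 0) (t : ℂ) : F t = 0 := by
  by_contra ht
  obtain ⟨s, hs1, hs2⟩ := polyC_both hF hG t t₂ ht h2
  exact hs1 (h s hs2)

/-- polynomial functions of several variables -/
noncomputable def PolyM (σ : Type) : Subalgebra ℂ ((σ → ℂ) → ℂ) :=
  (MvPolynomial.aeval (fun (i : σ) (t : σ → ℂ) => t i) :
    MvPolynomial σ ℂ →ₐ[ℂ] ((σ → ℂ) → ℂ)).range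

theorem polyM_iff {σ : Type} {F : (σ → ℂ) → ℂ} (h : F ∈ PolyM σ) :
    ∃ p : MvPolynomial σ ℂ, ∀ t, F t = MvPolynomial.eval t p := by
  obtain ⟨p, rfl⟩ := h
  refine ⟨p, fun t => ?_⟩
  induction p using MvPolynomial.induction_on with
  | C a => simp
  | add p q hp hq => simpa using congrArg₂ (· + ·) hp hq
  | mul_X p i hp =>
    have h2 := congrArg (· * t i) hp
    simpa using h2

theorem polyM_X {σ : Type} (i : σ) : (fun t : σ → ℂ => t i) ∈ PolyM σ :=
  ⟨MvPolynomial.X i, by simp⟩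

theorem ind_bound' {ι σ : Type} [Fintype σ] {S : Set (ι → ℂ)} {k : ℕ} (h : Ind S k)
    (Φ : (σ → ℂ) → ι → ℂ) (hp : ∀ i, (fun t => Φ t i) ∈ PolyM σ)
    (hΦ : ∀ f : MvPolynomial ι ℂ,
      (∀ t : σ → ℂ, MvPolynomial.eval (Φ t) f = 0) → Van S f) :
    k ≤ Fintype.card σ := by
  choose P hP using fun i => polyM_iff (hp i)
  refine ind_bound h P fun f hf => hΦ f fun t => ?_
  have : Φ t = fun i => MvPolynomial.eval t (P i) := by
    funext i; exact hP i t
  rw [this]; exact hf t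

end polyfun
end LG

namespace LG

section tensor

/-- two-by-two matrices -/
abbrev M2 := Matrix (Fin 2) (Fin 2) ℂ
/-- four-by-four matrices -/
abbrev M4 := Matrix (Fin 4) (Fin 4) ℂ

/-- the index equivalence -/
def e4 : Fin 2 × Fin 2 ≃ Fin 4 where
  toFun x := pairIdx x.1 x.2
  invFun i := (⟨i.val / 2, by omega⟩, ⟨i.val % 2, by omega⟩)
  left_inv := by decide
  right_inv := by decide

theorem pairIdx_eq (a b : Fin 2) : pairIdx a b = e4 (a, b) := rfl

/-- Kronecker product of one-qubit matrices -/
noncomputable def K2 (k k' : M2) : M4 := (k ⊗ₖ k').submatrix e4.symm e4.symm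

theorem K2_apply (k k' : M2) (a b c d : Fin 2) :
    K2 k k' (pairIdx a b) (pairIdx c d) = k a c * k' b d := by
  simp [K2, pairIdx_eq]

theorem K2_mul (k k' l l' : M2) : K2 k k' * K2 l l' = K2 (k * l) (k' * l') := by
  rw [K2, K2, Matrix.submatrix_mul_equiv, ← Matrix.mul_kronecker_mul, K2]

theorem K2_one : K2 1 1 = 1 := by simp [K2]

theorem K2_transpose (k k' : M2) : (K2 k k')ᵀ = K2 kᵀ k'ᵀ := by
  ext i j; simp [K2]

theorem single_eq_K2 (a b c d : Fin 2) :
    (Matrix.single (pairIdx a b) (pairIdx c d) (1 : ℂ) : M4) =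
      K2 (Matrix.single a c 1) (Matrix.single b d 1) := by
  ext i j
  obtain ⟨⟨i1, i2⟩, rfl⟩ := e4.surjective i
  obtain ⟨⟨j1, j2⟩, rfl⟩ := e4.surjective j
  simp only [← pairIdx_eq, K2_apply]
  simp only [pairIdx_eq, Matrix.single_apply, EmbeddingLike.apply_eq_iff_eq, Prod.mk.injEq]
  split_ifs <;> simp_all

theorem ext_K2 {V : Type*} [AddCommGroup V] [Module ℂ V] (φ ψ : M4 →ₗ[ℂ] V)
    (h : ∀ k k', φ (K2 k k') = ψ (K2 k k')) : φ = ψ := by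
  refine Matrix.ext_linearMap _ fun i j => ?_
  ext
  obtain ⟨⟨i1, i2⟩, rfl⟩ := e4.surjective i
  obtain ⟨⟨j1, j2⟩, rfl⟩ := e4.surjective j
  simp only [← pairIdx_eq, LinearMap.comp_apply, Matrix.singleLinearMap_apply, single_eq_K2]
  exact h _ _

variable {n : ℕ}

/-- tensor product operator -/
noncomputable def TT (m : Fin n → M2) : NMatrix n := fun a b => ∏ i, m i (a i) (b i)

theorem TT_mul (m m' : Fin n → M2) : TT m * TT m' = TT (m * m') := by
  ext a b
  simp only [TT, Matrix.mul_apply, Pi.mul_apply, ← Finset.prod_mul_distrib]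
  rw [Finset.prod_univ_sum]
  simp

theorem TT_one : TT (1 : Fin n → M2) = 1 := by
  ext a b
  simp only [TT, Pi.one_apply, Matrix.one_apply]
  by_cases h : a = b
  · simp [h]
  · rw [if_neg h]
    obtain ⟨i, hi⟩ := Function.ne_iff.mp h
    exact Finset.prod_eq_zero (Finset.mem_univ i) (if_neg hi)

theorem TT_update_apply (m : Fin n → M2) (i : Fin n) (x : M2) (a b : QubitBasis n) :
    TT (Function.update m i x) a b =
      x (a i) (b i) * ∏ j ∈ Finset.univ.erase i, m j (a j) (b j) := by
  rw [TT, ← Finset.mul_prod_erase _ _ (Finset.mem_univ i), Function.update_self]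
  congr 1
  refine Finset.prod_congr rfl fun j hj => ?_
  rw [Function.update_of_ne (Finset.ne_of_mem_erase hj)]

/-- tensor product operator, linear in one slot -/
noncomputable def TTl (m : Fin n → M2) (i : Fin n) : M2 →ₗ[ℂ] NMatrix n where
  toFun x := TT (Function.update m i x)
  map_add' x y := by
    ext a b; simp only [Matrix.add_apply, TT_update_apply]; ring
  map_smul' c x := by
    ext a b; simp only [Matrix.smul_apply, TT_update_apply, smul_eq_mul, RingHom.id_apply]; ring

/-- embedGate, complex linear -/
noncomputable def embC (p : Fin n × Fin n) : M4 →ₗ[ℂ] NMatrix n where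
  toFun := embedGate p
  map_add' u v := by
    funext a b
    simp only [embedGate, Matrix.add_apply]
    split <;> simp
  map_smul' r u := by
    funext a b
    simp only [embedGate, Matrix.smul_apply, RingHom.id_apply]
    split <;> simp

theorem embC_apply (p : Fin n × Fin n) (u : M4) : embC p u = embedGate p u := rfl

/-- one-qubit operators on two qubits -/
noncomputable def two (p : Fin n × Fin n) (k k' : M2) : Fin n → M2 :=
  Function.update (Function.update 1 p.1 k) p.2 k'

theorem two_fst {p : Fin n × Fin n} (hp : p.1 ≠ p.2) (k k' : M2) : two p k k' p.1 = k := by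
  rw [two, Function.update_of_ne hp, Function.update_self]

theorem two_snd (p : Fin n × Fin n) (k k' : M2) : two p k k' p.2 = k' := by
  rw [two, Function.update_self]

theorem two_other {p : Fin n × Fin n} (k k' : M2) {i : Fin n} (h1 : i ≠ p.1) (h2 : i ≠ p.2) :
    two p k k' i = 1 := by
  rw [two, Function.update_of_ne h2, Function.update_of_ne h1, Pi.one_apply]

theorem two_mul {p : Fin n × Fin n} (hp : p.1 ≠ p.2) (k k' l l' : M2) :
    two p k k' * two p l l' = two p (k * l) (k' * l') := by
  funext i
  rw [Pi.mul_apply]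
  by_cases h1 : i = p.1
  · subst h1; simp only [two_fst hp]
  · by_cases h2 : i = p.2
    · subst h2; simp only [two_snd]
    · simp only [two_other _ _ h1 h2, one_mul]

theorem embed_K2 {p : Fin n × Fin n} (hp : p.1 ≠ p.2) (k k' : M2) :
    embedGate p (K2 k k') = TT (two p k k') := by
  ext a b
  rw [embedGate, K2_apply, TT, ← Finset.mul_prod_erase _ _ (Finset.mem_univ p.1),
    ← Finset.mul_prod_erase _ _ (Finset.mem_erase.mpr ⟨hp.symm, Finset.mem_univ p.2⟩),
    two_fst hp, two_snd]
  have h3 : ∏ x ∈ (Finset.univ.erase p.1).erase p.2, two p k k' x (a x) (b x) =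
      ∏ x ∈ (Finset.univ.erase p.1).erase p.2, if a x = b x then (1 : ℂ) else 0 := by
    refine Finset.prod_congr rfl fun i hi => ?_
    simp only [Finset.mem_erase, Finset.mem_univ, and_true] at hi
    rw [two_other _ _ hi.2 hi.1, Matrix.one_apply]
  rw [h3, Finset.prod_ite_zero]
  simp only [Finset.mem_erase, Finset.mem_univ, and_true, Finset.prod_const_one]
  by_cases h : ∀ i, i ≠ p.1 → i ≠ p.2 → a i = b i
  · rw [if_pos h, if_pos (fun i hi => h i hi.2 hi.1)]; ring
  · rw [if_neg h, if_neg (fun h' => h fun i h1 h2 => h' i ⟨h2, h1⟩)]; ring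

theorem embed_one {p : Fin n × Fin n} (hp : p.1 ≠ p.2) : embedGate p (1 : M4) = 1 := by
  rw [← K2_one, embed_K2 hp, ← TT_one]
  congr 1
  simp [two]

theorem embed_mul {p : Fin n × Fin n} (hp : p.1 ≠ p.2) (u v : M4) :
    embedGate p (u * v) = embedGate p u * embedGate p v := by
  have key : ∀ k k' : M2, (embC p) ∘ₗ (LinearMap.mulLeft ℂ (K2 k k')) =
      (LinearMap.mulLeft ℂ (embedGate p (K2 k k'))) ∘ₗ embC p := by
    intro k k'
    refine ext_K2 _ _ fun l l' => ?_
    simp only [LinearMap.comp_apply, LinearMap.mulLeft_apply, embC_apply, K2_mul, embed_K2 hp,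
      TT_mul, two_mul hp]
  have key2 : (embC p) ∘ₗ (LinearMap.mulRight ℂ v) =
      (LinearMap.mulRight ℂ (embedGate p v)) ∘ₗ embC p := by
    refine ext_K2 _ _ fun k k' => ?_
    exact LinearMap.congr_fun (key k k') v
  exact LinearMap.congr_fun key2 u

theorem embed_comm {p : Fin n × Fin n} (hp : p.1 ≠ p.2) (m : Fin n → M2) (h1 : m p.1 = 1)
    (h2 : m p.2 = 1) (u : M4) : TT m * embedGate p u = embedGate p u * TT m := by
  have key : (LinearMap.mulLeft ℂ (TT m)) ∘ₗ embC p = (LinearMap.mulRight ℂ (TT m)) ∘ₗ embC p := by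
    refine ext_K2 _ _ fun k k' => ?_
    simp only [LinearMap.comp_apply, LinearMap.mulLeft_apply, LinearMap.mulRight_apply, embC_apply,
      embed_K2 hp, TT_mul]
    congr 1
    funext i
    simp only [Pi.mul_apply]
    by_cases hi : i = p.1
    · subst hi; rw [h1, one_mul, mul_one]
    · by_cases hi' : i = p.2
      · subst hi'; rw [h2, one_mul, mul_one]
      · rw [two_other _ _ hi hi', one_mul, mul_one]
  exact LinearMap.congr_fun key u

theorem TT_split {p : Fin n × Fin n} (hp : p.1 ≠ p.2) (m : Fin n → M2) :
    TT m = embedGate p (K2 (m p.1) (m p.2)) *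
      TT (Function.update (Function.update m p.1 1) p.2 1) := by
  rw [embed_K2 hp, TT_mul]
  congr 1
  funext i
  rw [Pi.mul_apply]
  by_cases hi : i = p.1
  · subst hi; rw [two_fst hp, Function.update_of_ne hp, Function.update_self, mul_one]
  · by_cases hi' : i = p.2
    · subst hi'; rw [two_snd, Function.update_self, mul_one]
    · rw [two_other _ _ hi hi', one_mul, Function.update_of_ne hi', Function.update_of_ne hi]

theorem embed_transpose (p : Fin n × Fin n) (u : M4) :
    (embedGate p u)ᵀ = embedGate p uᵀ := by
  ext a b
  simp only [Matrix.transpose_apply, embedGate]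
  congr 1
  apply propext
  exact forall_congr' fun i => forall_congr' fun _ => forall_congr' fun _ => eq_comm

theorem embed_smul (p : Fin n × Fin n) (c : ℂ) (u : M4) :
    embedGate p (c • u) = c • embedGate p u := (embC p).map_smul c u

theorem TT_transpose (m : Fin n → M2) : (TT m)ᵀ = TT (fun i => (m i)ᵀ) := by
  ext a b; simp [TT]

theorem TT_single (a b : QubitBasis n) :
    TT (fun i => Matrix.single (a i) (b i) 1) = Matrix.single a b 1 := by
  ext c d
  simp only [TT, Matrix.single_apply]
  by_cases h : a = c ∧ b = d
  · obtain ⟨rfl, rfl⟩ := h; simp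
  · rw [if_neg h]
    have : ∃ i, ¬ (a i = c i ∧ b i = d i) := by
      by_contra hc
      push Not at hc
      exact h ⟨funext fun i => (hc i).1, funext fun i => (hc i).2⟩
    obtain ⟨i, hi⟩ := this
    exact Finset.prod_eq_zero (Finset.mem_univ i) (if_neg hi)

end tensor
end LG

namespace LG
variable {n : ℕ}

/-- pairs of vectors -/
abbrev Pt (n : ℕ) := QubitBasis n ⊕ QubitBasis n → ℂ

/-- pair of matrices acting on a pair of vectors -/
noncomputable def act (G H : NMatrix n) (z : Pt n) : Pt n :=
  Sum.elim (G *ᵥ (z ∘ Sum.inl)) (H *ᵥ (z ∘ Sum.inr))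

theorem act_one (z : Pt n) : act 1 1 z = z := by
  ext i; cases i <;> simp [act]

theorem act_act (G H G' H' : NMatrix n) (z : Pt n) :
    act G H (act G' H' z) = act (G * G') (H * H') z := by
  ext i; cases i <;> simp [act]

/-- conical sets -/
def Cone (S : Set (Pt n)) : Prop := ∀ z ∈ S, ∀ c d : ℂ, act (c • 1) (d • 1) z ∈ S

theorem act_smul (G H : NMatrix n) (c d : ℂ) (z : Pt n) :
    act (c • G) (d • H) z = act G H (act (c • 1) (d • 1) z) := by
  rw [act_act]; simp

theorem act_smul' (G H : NMatrix n) (c d : ℂ) (z : Pt n) :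
    act (c • G) (d • H) z = act (c • 1) (d • 1) (act G H z) := by
  rw [act_act]; simp

/-- orbit under a gate -/
def Orb (p : Fin n × Fin n) (S : Set (Pt n)) : Set (Pt n) :=
  {w | ∃ g : M4, ∃ z ∈ S, w = act (embedGate p g) (embedGate p (g.adjugateᵀ)) z}

/-- orbit under a list of gates -/
def OrbL (l : List (Fin n × Fin n)) (S : Set (Pt n)) : Set (Pt n) :=
  l.foldl (fun S p => Orb p S) S

theorem orb_mono (p : Fin n × Fin n) {S S' : Set (Pt n)} (h : S ⊆ S') : Orb p S ⊆ Orb p S' := by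
  rintro w ⟨g, z, hz, rfl⟩; exact ⟨g, z, h hz, rfl⟩

theorem orb_sub {p : Fin n × Fin n} (hp : p.1 ≠ p.2) (S : Set (Pt n)) : S ⊆ Orb p S := by
  intro z hz
  refine ⟨1, z, hz, ?_⟩
  rw [Matrix.adjugate_one, Matrix.transpose_one, embed_one hp, act_one]

theorem orb_cone {p : Fin n × Fin n} {S : Set (Pt n)} (h : Cone S) : Cone (Orb p S) := by
  rintro w ⟨g, z, hz, rfl⟩ c d
  exact ⟨g, _, h z hz c d, by rw [← act_smul, ← act_smul']⟩

theorem orb_of_scalar {p : Fin n × Fin n} {S : Set (Pt n)} (h : Cone S) (g k : M4) (c : ℂ)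
    (hc : c ≠ 0) (hgk : gᵀ * k = c • 1) {z : Pt n} (hz : z ∈ S) :
    act (embedGate p g) (embedGate p k) z ∈ Orb p S := by
  have h1 : kᵀ * g = c • 1 := by
    have := congrArg Matrix.transpose hgk
    simpa using this
  have hdet : g.det ≠ 0 := by
    intro h0
    have := congrArg Matrix.det hgk
    rw [Matrix.det_mul, Matrix.det_transpose, h0] at this
    simp at this
    exact hc (pow_eq_zero_iff (by norm_num) |>.mp this.symm)
  have hadj : g.adjugateᵀ = (g.det * c⁻¹) • k := by
    have h2 : c • g.adjugate = g.det • kᵀ := by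
      calc c • g.adjugate = (kᵀ * g) * g.adjugate := by rw [h1]; simp
        _ = g.det • kᵀ := by rw [Matrix.mul_assoc, Matrix.mul_adjugate]; simp
    have h3 : g.adjugate = (g.det * c⁻¹) • kᵀ := by
      rw [mul_comm, mul_smul, ← h2, smul_smul, inv_mul_cancel₀ hc, one_smul]
    rw [h3]; simp
  refine ⟨g, _, h z hz 1 (c * g.det⁻¹), ?_⟩
  rw [hadj, embed_smul, act_act, ]
  congr 1
  · simp
  · simp only [Algebra.mul_smul_comm, mul_one, smul_smul]
    rw [show c * g.det⁻¹ * (g.det * c⁻¹) = 1 by field_simp, one_smul]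

theorem orbL_append (l l' : List (Fin n × Fin n)) (S : Set (Pt n)) :
    OrbL (l ++ l') S = OrbL l' (OrbL l S) := by simp [OrbL]

theorem orbL_sub {l : List (Fin n × Fin n)} (hl : ∀ p ∈ l, p.1 ≠ p.2) (S : Set (Pt n)) :
    S ⊆ OrbL l S := by
  induction l generalizing S with
  | nil => exact subset_rfl
  | cons p l ih =>
    exact (orb_sub (hl p (by simp)) S).trans (ih (fun q hq => hl q (by simp [hq])) _)

theorem orbL_mono (l : List (Fin n × Fin n)) {S S' : Set (Pt n)} (h : S ⊆ S') :
    OrbL l S ⊆ OrbL l S' := by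
  induction l generalizing S S' with
  | nil => exact h
  | cons p l ih => exact ih (orb_mono p h)

theorem orb_sub_orbL {l : List (Fin n × Fin n)} (hl : ∀ p ∈ l, p.1 ≠ p.2) {p : Fin n × Fin n}
    (hp : p ∈ l) (S : Set (Pt n)) : Orb p S ⊆ OrbL l S := by
  obtain ⟨l1, l2, rfl⟩ := List.append_of_mem hp
  rw [orbL_append]
  have h1 : S ⊆ OrbL l1 S := orbL_sub (fun q hq => hl q (by simp [hq])) S
  refine (orb_mono p h1).trans ?_
  exact orbL_sub (fun q hq => hl q (by simp [hq])) (Orb p (OrbL l1 S))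

theorem orbL_cone {l : List (Fin n × Fin n)} {S : Set (Pt n)} (h : Cone S) : Cone (OrbL l S) := by
  induction l generalizing S with
  | nil => exact h
  | cons p l ih => exact ih (orb_cone h)

theorem mem_act {T : Type} (𝒜 : Subalgebra ℂ (T → ℂ)) (G H : T → NMatrix n) (z : T → Pt n)
    (hG : ∀ i j, (fun t => G t i j) ∈ 𝒜) (hH : ∀ i j, (fun t => H t i j) ∈ 𝒜)
    (hz : ∀ i, (fun t => z t i) ∈ 𝒜) (i : QubitBasis n ⊕ QubitBasis n) :
    (fun t => act (G t) (H t) (z t) i) ∈ 𝒜 := by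
  cases i with
  | inl i => exact mem_mulVec 𝒜 G (fun t => z t ∘ Sum.inl) hG (fun j => hz (Sum.inl j)) i
  | inr i => exact mem_mulVec 𝒜 H (fun t => z t ∘ Sum.inr) hH (fun j => hz (Sum.inr j)) i

theorem mem_embed {T : Type} (𝒜 : Subalgebra ℂ (T → ℂ)) (p : Fin n × Fin n) (g : T → M4)
    (hg : ∀ i j, (fun t => g t i j) ∈ 𝒜) (i j : QubitBasis n) :
    (fun t => embedGate p (g t) i j) ∈ 𝒜 := by
  simp only [embedGate]
  split
  · exact hg _ _
  · exact mem_const 𝒜 0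

/-- pull back of a polynomial -/
theorem pull (G H : NMatrix n) (f : MvPolynomial (QubitBasis n ⊕ QubitBasis n) ℂ) :
    ∃ f' : MvPolynomial (QubitBasis n ⊕ QubitBasis n) ℂ,
      ∀ z, MvPolynomial.eval z f' = MvPolynomial.eval (act G H z) f := by
  have : (fun z : Pt n => MvPolynomial.eval (act G H z) f) ∈ PolyM (QubitBasis n ⊕ QubitBasis n) :=
    mem_eval _ f (fun z => act G H z) (mem_act _ (fun _ => G) (fun _ => H) (fun z => z)
      (fun i j => mem_const _ _) (fun i j => mem_const _ _) (fun i => polyM_X i))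
  obtain ⟨p, hp⟩ := polyM_iff this
  exact ⟨p, fun z => (hp z).symm⟩

theorem irr_both {ι : Type} {S : Set (ι → ℂ)} (h : Irr S) {f g : MvPolynomial ι ℂ} (hf : ¬ Van S f)
    (hg : ¬ Van S g) : ∃ z ∈ S, MvPolynomial.eval z f ≠ 0 ∧ MvPolynomial.eval z g ≠ 0 := by
  by_contra hc
  push Not at hc
  rcases h f g (fun z hz => by
    rw [map_mul]
    by_cases h0 : MvPolynomial.eval z f = 0
    · simp [h0]
    · simp [hc z hz h0]) with h | h
  · exact hf h
  · exact hg h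

theorem irr_orb (p : Fin n × Fin n) {S : Set (Pt n)} (h : Irr S) : Irr (Orb p S) := by
  intro f k hfk
  by_contra hc
  push Not at hc
  obtain ⟨hf, hk⟩ := hc
  simp only [Van, not_forall] at hf hk
  obtain ⟨_, ⟨g1, z1, hz1, rfl⟩, h1⟩ := hf
  obtain ⟨_, ⟨g2, z2, hz2, rfl⟩, h2⟩ := hk
  obtain ⟨f', hf'⟩ := pull (embedGate p g1) (embedGate p (g1.adjugateᵀ)) f
  obtain ⟨k', hk'⟩ := pull (embedGate p g2) (embedGate p (g2.adjugateᵀ)) k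
  obtain ⟨z, hz, hzf, hzk⟩ := irr_both h (f := f') (g := k')
    (fun hv => h1 (by rw [← hf']; exact hv z1 hz1)) (fun hv => h2 (by rw [← hk']; exact hv z2 hz2))
  rw [hf'] at hzf
  rw [hk'] at hzk
  set g : ℂ → M4 := fun t => g1 + t • (g2 - g1) with hg
  have hgp : ∀ i j, (fun t => g t i j) ∈ PolyC := fun i j =>
    mem_add _ (mem_const _ _) (mem_mul _ polyC_id (mem_const _ _))
  have hP : ∀ q : MvPolynomial (QubitBasis n ⊕ QubitBasis n) ℂ,
      (fun t => MvPolynomial.eval (act (embedGate p (g t)) (embedGate p ((g t).adjugateᵀ)) z) q)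
        ∈ PolyC := fun q =>
    mem_eval _ q _ (mem_act _ _ _ _ (mem_embed _ p _ hgp)
      (mem_embed _ p _ (fun i j => mem_adj _ _ hgp j i)) (fun i => mem_const _ _))
  obtain ⟨t, ht1, ht2⟩ := polyC_both (hP f) (hP k) 0 1 (by simpa [hg] using hzf)
    (by simpa [hg] using hzk)
  have := hfk _ ⟨g t, z, hz, rfl⟩
  rw [map_mul] at this
  exact (mul_ne_zero ht1 ht2) this

theorem irr_orbL (l : List (Fin n × Fin n)) {S : Set (Pt n)} (h : Irr S) : Irr (OrbL l S) := by
  induction l generalizing S with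
  | nil => exact h
  | cons p l ih => exact ih (irr_orb p h)

/-- contraction for general matrices -/
noncomputable def contr {R : ℕ} (A : Architecture n R) (g : Fin R → M4) : NMatrix n :=
  ((List.ofFn fun i => embedGate (A i).1 (g i)).reverse).prod

/-- the list of pairs -/
def prs {R : ℕ} (A : Architecture n R) : List (Fin n × Fin n) := List.ofFn fun i => (A i).1

theorem prs_ne {R : ℕ} (A : Architecture n R) : ∀ p ∈ prs A, p.1 ≠ p.2 := by
  intro p hp
  rw [prs, List.mem_ofFn] at hp
  obtain ⟨i, rfl⟩ := hp
  exact (A i).2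

/-- drop the first gate -/
def tl {R : ℕ} (A : Architecture n (R + 1)) : Architecture n R := fun i => A i.succ

theorem contr_succ {R : ℕ} (A : Architecture n (R + 1)) (g : Fin (R + 1) → M4) :
    contr A g = contr (tl A) (fun i => g i.succ) *
      embedGate (A 0).1 (g 0) := by
  simp [contr, tl, List.ofFn_succ]

theorem mem_orbL_prs {R : ℕ} (A : Architecture n R) (S : Set (Pt n)) (w : Pt n) :
    w ∈ OrbL (prs A) S ↔ ∃ g : Fin R → M4, ∃ z ∈ S,
      w = act (contr A g) (contr A (fun i => (g i).adjugateᵀ)) z := by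
  induction R generalizing S with
  | zero =>
    simp [prs, OrbL, contr, act_one]
  | succ R ih =>
    have : OrbL (prs A) S = OrbL (prs (tl A)) (Orb (A 0).1 S) := by
      simp [prs, OrbL, tl, List.ofFn_succ]
    rw [this, ih]
    constructor
    · rintro ⟨g, _, ⟨g0, z, hz, rfl⟩, rfl⟩
      refine ⟨Fin.cons g0 g, z, hz, ?_⟩
      rw [act_act, contr_succ, contr_succ]
      simp
    · rintro ⟨g, z, hz, rfl⟩
      refine ⟨fun i => g i.succ, _, ⟨g 0, z, hz, rfl⟩, ?_⟩
      rw [act_act, contr_succ, contr_succ]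

theorem contract_eq {R : ℕ} (A : Architecture n R) (x : Fin R → SU4) :
    contract A x = contr A (fun i => (x i : M4)) := rfl

/-- base set -/
noncomputable def pt0 (n : ℕ) : Pt n := Sum.elim (ket0 n) (ket0 n)
/-- base cone -/
noncomputable def S0 (n : ℕ) : Set (Pt n) := {w | ∃ c d : ℂ, w = act (c • 1) (d • 1) (pt0 n)}

theorem S0_cone : Cone (S0 n) := by
  rintro _ ⟨c, d, rfl⟩ c' d'
  exact ⟨c' * c, d' * d, by rw [act_act]; simp [smul_smul, mul_comm]⟩

theorem S0_pt0 : pt0 n ∈ S0 n := ⟨1, 1, by rw [one_smul, act_one]⟩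

theorem S0_irr : Irr (S0 n) := by
  intro f g hfg
  by_contra hc
  push Not at hc
  obtain ⟨hf, hg⟩ := hc
  simp only [Van, not_forall] at hf hg
  obtain ⟨_, ⟨c1, d1, rfl⟩, h1⟩ := hf
  obtain ⟨_, ⟨c2, d2, rfl⟩, h2⟩ := hg
  have hP : ∀ q : MvPolynomial (QubitBasis n ⊕ QubitBasis n) ℂ,
      (fun t : ℂ => MvPolynomial.eval (act ((c1 + t * (c2 - c1)) • 1) ((d1 + t * (d2 - d1)) • 1)
        (pt0 n)) q) ∈ PolyC := by
    intro q
    have hl : ∀ a b : ℂ, (fun t : ℂ => a + t * b) ∈ PolyC := fun a b =>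
      mem_add _ (mem_const _ _) (mem_mul _ polyC_id (mem_const _ _))
    exact mem_eval _ q _ (mem_act _ _ _ _ (fun i j => mem_mul _ (hl _ _) (mem_const _ _))
      (fun i j => mem_mul _ (hl _ _) (mem_const _ _)) (fun i => mem_const _ _))
  obtain ⟨t, ht1, ht2⟩ := polyC_both (hP f) (hP g) 0 1 (by simpa using h1) (by simpa using h2)
  have := hfg _ ⟨c1 + t * (c2 - c1), d1 + t * (d2 - d1), rfl⟩
  rw [map_mul] at this
  exact (mul_ne_zero ht1 ht2) this
end LG

namespace LG
section gen
variable {ι : Type} [Fintype ι]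

/-- derivations of the polynomial ring -/
abbrev Der (ι : Type) := Derivation ℂ (MvPolynomial ι ℂ) (MvPolynomial ι ℂ)

/-- stability of the vanishing ideal -/
def Stab (S : Set (ι → ℂ)) (D : Der ι) : Prop := ∀ f, Van S f → Van S (D f)

theorem line_poly (z w : ι → ℂ) (f : MvPolynomial ι ℂ) :
    ∃ p : Polynomial ℂ, (∀ t, p.eval t = MvPolynomial.eval (z + t • w) f) ∧
      p.derivative.eval 0 = ∑ i, w i * MvPolynomial.eval z (MvPolynomial.pderiv i f) := by
  induction f using MvPolynomial.induction_on with
  | C a => exact ⟨Polynomial.C a, by simp, by simp⟩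
  | add f g hf hg =>
    obtain ⟨p, hp, hp'⟩ := hf
    obtain ⟨q, hq, hq'⟩ := hg
    refine ⟨p + q, by simp [hp, hq], ?_⟩
    simp [hp', hq', mul_add, Finset.sum_add_distrib]
  | mul_X f j hf =>
    obtain ⟨p, hp, hp'⟩ := hf
    refine ⟨p * (Polynomial.C (z j) + Polynomial.X * Polynomial.C (w j)), by intro t; simp [hp]; left; ring, ?_⟩
    have h0 := hp 0
    simp only [zero_smul, add_zero] at h0
    simp only [Polynomial.derivative_mul, Polynomial.eval_add, Polynomial.eval_mul, hp', h0,
      Polynomial.eval_C, Polynomial.eval_X, Polynomial.derivative_add, Polynomial.derivative_C,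
      Polynomial.derivative_X, MvPolynomial.pderiv_mul, MvPolynomial.pderiv_X, map_add, map_mul,
      MvPolynomial.eval_X, mul_add, Finset.sum_add_distrib, Finset.sum_mul]
    simp [Pi.single_apply, apply_ite, mul_comm]
    exact Finset.sum_congr rfl fun x _ => by ring

theorem der_sum {κ : Type} (s : Finset κ) (D : κ → Der ι) (f : MvPolynomial ι ℂ) :
    (∑ k ∈ s, D k) f = ∑ k ∈ s, D k f := by
  induction s using Finset.induction_on with
  | empty => simp
  | insert a s ha ih => rw [Finset.sum_insert ha, Finset.sum_insert ha, Derivation.add_apply, ih]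

theorem eval_mkDer (v : ι → MvPolynomial ι ℂ) (f : MvPolynomial ι ℂ) :
    MvPolynomial.mkDerivation ℂ v f = ∑ i, v i * MvPolynomial.pderiv i f := by
  have : MvPolynomial.mkDerivation ℂ v = ∑ i, v i • (MvPolynomial.pderiv i : Der ι) := by
    apply MvPolynomial.derivation_ext
    intro j
    rw [MvPolynomial.mkDerivation_X]
    simp [der_sum, MvPolynomial.pderiv_X, Pi.single_apply]
  rw [this]
  simp [der_sum]

theorem stab_of_line {S : Set (ι → ℂ)} (v : ι → MvPolynomial ι ℂ)
    (h : ∀ f, Van S f → ∀ z ∈ S,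
      {t : ℂ | MvPolynomial.eval (z + t • (fun i => MvPolynomial.eval z (v i))) f = 0}.Infinite) :
    Stab S (MvPolynomial.mkDerivation ℂ v) := by
  intro f hf z hz
  obtain ⟨p, hp, hp'⟩ := line_poly z (fun i => MvPolynomial.eval z (v i)) f
  have hinf := h f hf z hz
  have : p = 0 := by
    apply Polynomial.eq_zero_of_infinite_isRoot
    refine hinf.mono fun t ht => ?_
    simp only [Set.mem_setOf_eq, Polynomial.IsRoot.def] at ht ⊢
    rw [hp]; exact ht
  rw [eval_mkDer, map_sum]
  simp only [map_mul]
  rw [← hp', this]; simp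

theorem Stab.add {S : Set (ι → ℂ)} {D D' : Der ι} (h : Stab S D) (h' : Stab S D') :
    Stab S (D + D') := fun f hf z hz => by
  simp [h f hf z hz, h' f hf z hz]

theorem Stab.sub {S : Set (ι → ℂ)} {D D' : Der ι} (h : Stab S D) (h' : Stab S D') :
    Stab S (D - D') := fun f hf z hz => by
  simp [h f hf z hz, h' f hf z hz]

theorem Stab.smul {S : Set (ι → ℂ)} {D : Der ι} (h : Stab S D) (q : MvPolynomial ι ℂ) :
    Stab S (q • D) := fun f hf z hz => by
  simp [h f hf z hz]

theorem Stab.csmul {S : Set (ι → ℂ)} {D : Der ι} (h : Stab S D) (q : ℂ) :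
    Stab S (q • D) := fun f hf z hz => by
  simp [h f hf z hz]

theorem Stab.sum {κ : Type} {S : Set (ι → ℂ)} (s : Finset κ) {D : κ → Der ι}
    (h : ∀ k ∈ s, Stab S (D k)) : Stab S (∑ k ∈ s, D k) := fun f hf z hz => by
  simp only [der_sum, map_sum]
  exact Finset.sum_eq_zero fun k hk => h k hk f hf z hz

theorem Stab.lie {S : Set (ι → ℂ)} {D D' : Der ι} (h : Stab S D) (h' : Stab S D') :
    Stab S ⁅D, D'⁆ := fun f hf z hz => by
  rw [Derivation.commutator_apply, map_sub, h _ (h' f hf) z hz, h' _ (h f hf) z hz, sub_zero]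

theorem Stab.cancel {S : Set (ι → ℂ)} (hI : Irr S) {D : Der ι} (q : MvPolynomial ι ℂ)
    (hq : ¬ Van S q) (h : Stab S (q • D)) : Stab S D := fun f hf => by
  have := h f hf
  rw [Derivation.smul_apply, smul_eq_mul] at this
  exact (hI _ _ this).resolve_left hq


theorem full_of_pderiv {S : Set (ι → ℂ)} (hS : S.Nonempty)
    (h : ∀ i, Stab S (MvPolynomial.pderiv i : Der ι)) (f : MvPolynomial ι ℂ) (hf : Van S f) :
    f = 0 := by
  suffices H : ∀ d : ℕ, ∀ f : MvPolynomial ι ℂ, Van S f →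
      (∀ m : ι →₀ ℕ, d ≤ m.degree → f.coeff m = 0) → f = 0 by
    refine H (f.totalDegree + 1) f hf fun m hm => ?_
    apply MvPolynomial.coeff_eq_zero_of_totalDegree_lt
    have : m.degree = ∑ i ∈ m.support, m i := rfl
    omega
  intro d
  induction d with
  | zero => intro f _ h0; ext m; simp [h0 m (Nat.zero_le _)]
  | succ d ih =>
    intro f hf h0
    have h1 : ∀ i, MvPolynomial.pderiv i f = 0 := by
      intro i
      apply ih _ (h i f hf)
      intro m hm
      rw [MvPolynomial.coeff_pderiv, h0, zero_mul]
      simp [map_add]; omega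
    have h2 : ∀ m : ι →₀ ℕ, m ≠ 0 → f.coeff m = 0 := by
      intro m hm
      obtain ⟨i, hi⟩ := Finsupp.ne_iff.mp hm
      have h3 := congrArg (MvPolynomial.coeff (m - Finsupp.single i 1)) (h1 i)
      rw [MvPolynomial.coeff_pderiv] at h3
      have h4 : m - Finsupp.single i 1 + Finsupp.single i 1 = m := by
        ext j
        by_cases hj : i = j
        · subst hj; simp at hi ⊢; omega
        · simp [Finsupp.single_apply, hj]
      rw [h4] at h3
      simp only [MvPolynomial.coeff_zero, mul_eq_zero] at h3
      rcases h3 with h3 | h3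
      · exact h3
      · exact absurd h3 (by positivity)
    have h5 : f = MvPolynomial.C (f.coeff 0) := by
      ext m
      rw [MvPolynomial.coeff_C]
      split
      · next h => rw [h]
      · next h => exact h2 m (Ne.symm h)
    obtain ⟨z, hz⟩ := hS
    have h6 := hf z hz
    rw [h5, MvPolynomial.eval_C] at h6
    rw [h5, h6, map_zero]
end gen
end LG

namespace LG
variable {n : ℕ}

/-- coordinate index -/
abbrev QQ (n : ℕ) := QubitBasis n ⊕ QubitBasis n
/-- first coordinates -/
noncomputable def ps (a : QubitBasis n) : MvPolynomial (QQ n) ℂ := MvPolynomial.X (Sum.inl a)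
/-- second coordinates -/
noncomputable def ph (a : QubitBasis n) : MvPolynomial (QQ n) ℂ := MvPolynomial.X (Sum.inr a)

/-- vector field of a matrix -/
noncomputable def vX (X : NMatrix n) : QQ n → MvPolynomial (QQ n) ℂ :=
  Sum.elim (fun a => ∑ b, MvPolynomial.C (X a b) * ps b)
    (fun a => - ∑ b, MvPolynomial.C (X b a) * ph b)

/-- derivation of a matrix -/
noncomputable def DX (X : NMatrix n) : Der (QQ n) := MvPolynomial.mkDerivation ℂ (vX X)

theorem DX_ps (X : NMatrix n) (a : QubitBasis n) :
    DX X (ps a) = ∑ b, MvPolynomial.C (X a b) * ps b := by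
  rw [DX, ps, MvPolynomial.mkDerivation_X]; rfl

theorem DX_ph (X : NMatrix n) (a : QubitBasis n) :
    DX X (ph a) = - ∑ b, MvPolynomial.C (X b a) * ph b := by
  rw [DX, ph, MvPolynomial.mkDerivation_X]; rfl

theorem der_ext {D D' : Der (QQ n)} (h1 : ∀ a, D (ps a) = D' (ps a))
    (h2 : ∀ a, D (ph a) = D' (ph a)) : D = D' := by
  apply MvPolynomial.derivation_ext
  intro i
  cases i with
  | inl a => exact h1 a
  | inr a => exact h2 a

theorem DX_add (X Y : NMatrix n) : DX (X + Y) = DX X + DX Y := by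
  apply der_ext <;> intro a
  · simp [DX_ps, add_mul, Finset.sum_add_distrib]
  · simp [DX_ph, add_mul, Finset.sum_add_distrib, add_comm]

theorem DX_smul (c : ℂ) (X : NMatrix n) : DX (c • X) = c • DX X := by
  apply der_ext <;> intro a
  · simp [DX_ps, MvPolynomial.smul_eq_C_mul, Finset.mul_sum, mul_assoc]
  · simp [DX_ph, MvPolynomial.smul_eq_C_mul, Finset.mul_sum, mul_assoc]

theorem DX_zero : DX (0 : NMatrix n) = 0 := by
  have := DX_smul (n := n) 0 0
  simpa using this

theorem DX_lie (X Y : NMatrix n) : ⁅DX X, DX Y⁆ = DX (Y * X - X * Y) := by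
  have hC : ∀ (D : Der (QQ n)) (c : ℂ) (f : MvPolynomial (QQ n) ℂ),
      D (MvPolynomial.C c * f) = MvPolynomial.C c * D f := by
    intro D c f
    rw [← MvPolynomial.smul_eq_C_mul, Derivation.map_smul, MvPolynomial.smul_eq_C_mul]
  have key1 : ∀ X Y : NMatrix n, ∀ a, DX X (DX Y (ps a)) =
      ∑ b, MvPolynomial.C ((Y * X) a b) * ps b := by
    intro X Y a
    simp only [DX_ps, map_sum, hC, Finset.mul_sum, Matrix.mul_apply, Finset.sum_mul]
    rw [Finset.sum_comm]
    simp [mul_assoc]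
  have key2 : ∀ X Y : NMatrix n, ∀ a, DX X (DX Y (ph a)) =
      ∑ b, MvPolynomial.C ((X * Y) b a) * ph b := by
    intro X Y a
    simp only [DX_ph, map_sum, map_neg, hC, Finset.mul_sum, Matrix.mul_apply, Finset.sum_mul,
      mul_neg, Finset.sum_neg_distrib, neg_neg]
    rw [Finset.sum_comm]
    simp [mul_left_comm, mul_assoc]
  apply der_ext <;> intro a
  · rw [Derivation.commutator_apply, key1, key1, DX_ps]
    simp [sub_mul]
  · rw [Derivation.commutator_apply, key2, key2, DX_ph]
    simp [sub_mul]

/-- stable matrices -/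
noncomputable def LL (S : Set (Pt n)) : Submodule ℂ (NMatrix n) where
  carrier := {X | Stab S (DX X)}
  add_mem' {X Y} h h' := by
    change Stab S (DX (X + Y)); rw [DX_add]; exact Stab.add h h'
  zero_mem' := by
    change Stab S (DX 0); rw [DX_zero]; intro f _ z _; simp
  smul_mem' c X h := by
    change Stab S (DX (c • X)); rw [DX_smul]; exact Stab.csmul h c

theorem LL_lie {S : Set (Pt n)} {X Y : NMatrix n} (h : X ∈ LL S) (h' : Y ∈ LL S) :
    X * Y - Y * X ∈ LL S := by
  change Stab S _
  rw [← DX_lie]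
  exact Stab.lie h' h

/-- Euler vector fields -/
noncomputable def EE (c d : ℂ) : Der (QQ n) :=
  MvPolynomial.mkDerivation ℂ (Sum.elim (fun a => c • ps a) (fun a => d • ph a))

theorem EE_ps (c d : ℂ) (a : QubitBasis n) : EE c d (ps a) = c • ps a := by
  rw [EE, ps, MvPolynomial.mkDerivation_X]; rfl

theorem EE_ph (c d : ℂ) (a : QubitBasis n) : EE c d (ph a) = d • ph a := by
  rw [EE, ph, MvPolynomial.mkDerivation_X]; rfl

theorem EE_stab {S : Set (Pt n)} (h : Cone S) (c d : ℂ) : Stab S (EE c d) := by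
  apply stab_of_line
  intro f hf z hz
  refine Set.infinite_univ.mono fun t _ => ?_
  have := hf _ (h z hz (1 + t * c) (1 + t * d))
  rw [Set.mem_setOf_eq]
  convert this using 3
  ext i
  cases i <;> simp [act, ps, ph, Matrix.smul_mulVec] <;> ring

theorem embed_single_mem {S : Set (Pt n)} (h : Cone S) {p : Fin n × Fin n} (hp : p.1 ≠ p.2)
    (hS : ∀ f, Van S f → Van (Orb p S) f) (a b : Fin 4) :
    embedGate p (Matrix.single a b 1) ∈ LL S := by
  set E : M4 := Matrix.single a b 1 with hE
  set τ : ℂ := if a = b then 1 else 0 with hτ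
  have hEE : E * E = τ • E := by
    rw [hE, hτ]
    split
    · next h => subst h; simp
    · next h => rw [Matrix.single_mul_single_of_ne _ _ _ _ (Ne.symm h)]; simp
  change Stab S _
  have h1 : Stab S (DX (embedGate p E) + EE 0 τ) := by
    have : DX (embedGate p E) + EE 0 τ = MvPolynomial.mkDerivation ℂ
        (fun i => vX (embedGate p E) i + Sum.elim (fun a => (0:ℂ) • ps a) (fun a => τ • ph a) i) := by
      apply MvPolynomial.derivation_ext
      intro i
      rw [Derivation.add_apply, DX, EE]
      simp only [MvPolynomial.mkDerivation_X]
    rw [this]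
    apply stab_of_line
    intro f hf z hz
    have hinf : {t : ℂ | 1 + t * τ ≠ 0}.Infinite := by
      refine (Set.finite_singleton (-1 : ℂ)).infinite_compl.mono fun t ht => ?_
      rw [Set.mem_setOf_eq, hτ]
      split
      · intro h0; apply ht; simp; linear_combination h0
      · simp
    refine hinf.mono fun t ht => ?_
    have hsc : (1 + t • E)ᵀ * ((1 + t * τ) • 1 - t • Eᵀ) = (1 + t * τ) • (1 : M4) := by
      have hEE' : Eᵀ * Eᵀ = τ • Eᵀ := by rw [← Matrix.transpose_mul, hEE, Matrix.transpose_smul]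
      rw [Matrix.transpose_add, Matrix.transpose_one, Matrix.transpose_smul, add_mul, one_mul,
        mul_sub]
      simp only [Matrix.smul_mul, Matrix.mul_smul, mul_one, hEE']
      module
    have := hS f hf _ (orb_of_scalar (p := p) h _ _ _ ht hsc hz)
    rw [Set.mem_setOf_eq]
    convert this using 3
    have e1 : embedGate p (1 + t • E) = 1 + t • embedGate p E := by
      rw [← embed_one hp, ← embed_smul]; exact (embC p).map_add _ _
    have e2 : embedGate p ((1 + t * τ) • 1 - t • Eᵀ) = (1 + t * τ) • 1 - t • (embedGate p E)ᵀ := by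
      rw [← embed_one hp, ← embed_smul, embed_transpose, ← embed_smul]; exact (embC p).map_sub _ _
    rw [e1, e2]
    ext i
    cases i with
    | inl i =>
      simp [act, vX, ps, Matrix.add_mulVec, Matrix.smul_mulVec, Matrix.mulVec, dotProduct]
    | inr i =>
      simp [act, vX, ph, Matrix.sub_mulVec, Matrix.smul_mulVec]
      simp [Matrix.mulVec, dotProduct]
      ring
  have h2 : DX (embedGate p E) = (DX (embedGate p E) + EE 0 τ) - EE 0 τ := by abel
  rw [h2]
  exact h1.sub (EE_stab h _ _)

theorem embed_mem {S : Set (Pt n)} (h : Cone S) {p : Fin n × Fin n} (hp : p.1 ≠ p.2)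
    (hS : ∀ f, Van S f → Van (Orb p S) f) (u : M4) : embedGate p u ∈ LL S := by
  have : u = ∑ a, ∑ b, u a b • (Matrix.single a b 1 : M4) := by
    conv_lhs => rw [Matrix.matrix_eq_sum_single u]
    simp
  rw [this, ← embC_apply, map_sum]
  refine Submodule.sum_mem _ fun a _ => ?_
  rw [map_sum]
  refine Submodule.sum_mem _ fun b _ => ?_
  rw [map_smul]
  exact Submodule.smul_mem _ _ (embed_single_mem h hp hS a b)

theorem m2_comm (V : Submodule ℂ M2) (h1 : (1 : M2) ∈ V) (h : ∀ x y : M2, x * y - y * x ∈ V)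
    (x : M2) : x ∈ V := by
  have : x = ((x 0 0 + x 1 1) / 2) • (1 : M2) +
      ((x 0 0 - x 1 1) / 2) • (!![0, 1; 0, 0] * !![0, 0; 1, 0] - !![0, 0; 1, 0] * !![0, 1; 0, 0]) +
      x 0 1 • (!![1, 0; 0, 0] * !![0, 1; 0, 0] - !![0, 1; 0, 0] * !![1, 0; 0, 0]) +
      x 1 0 • (!![0, 0; 0, 1] * !![0, 0; 1, 0] - !![0, 0; 1, 0] * !![0, 0; 0, 1]) := by
    ext i j
    fin_cases i <;> fin_cases j <;> simp <;> ring
  rw [this]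
  exact V.add_mem (V.add_mem (V.add_mem (V.smul_mem _ h1) (V.smul_mem _ (h _ _)))
    (V.smul_mem _ (h _ _))) (V.smul_mem _ (h _ _))

/-- all operators supported on `Q` -/
def CQ (V : Submodule ℂ (NMatrix n)) (Q : Finset (Fin n)) : Prop :=
  ∀ m : Fin n → M2, (∀ i, i ∉ Q → m i = 1) → TT m ∈ V

theorem CQ_step (V : Submodule ℂ (NMatrix n)) (hV : ∀ X ∈ V, ∀ Y ∈ V, X * Y - Y * X ∈ V)
    {Q : Finset (Fin n)} (hQ : CQ V Q) {i j : Fin n} (hi : i ∈ Q) (hj : j ∉ Q)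
    (hp : ∀ x w : M2, TT (Function.update (Function.update 1 i x) j w) ∈ V) :
    CQ V (insert j Q) := by
  have hij : i ≠ j := fun h => hj (h ▸ hi)
  intro m hm
  set m0 := Function.update m j 1 with hm0
  have hm0j : m0 j = 1 := by simp [hm0]
  have hm0Q : ∀ k, k ∉ Q → m0 k = 1 := by
    intro k hk
    by_cases hkj : k = j
    · rw [hkj, hm0j]
    · rw [hm0, Function.update_of_ne hkj]
      exact hm k (by simp [hk, hkj])
  have prodl : ∀ x y w w' : M2, TT (Function.update (Function.update m0 i x) j w) *
      TT (Function.update (Function.update 1 i y) j w') =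
      TT (Function.update (Function.update m0 i (x * y)) j (w * w')) := by
    intro x y w w'
    rw [TT_mul]
    congr 1
    funext k
    rw [Pi.mul_apply]
    by_cases hkj : k = j
    · subst hkj; simp
    · by_cases hki : k = i
      · subst hki; simp [hij]
      · simp [hkj, hki]
  have prodr : ∀ x y w w' : M2, TT (Function.update (Function.update 1 i y) j w') *
      TT (Function.update (Function.update m0 i x) j w) =
      TT (Function.update (Function.update m0 i (y * x)) j (w' * w)) := by
    intro x y w w'
    rw [TT_mul]
    congr 1
    funext k
    rw [Pi.mul_apply]
    by_cases hkj : k = j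
    · subst hkj; simp
    · by_cases hki : k = i
      · subst hki; simp [hij]
      · simp [hkj, hki]
  have slotj : ∀ x w, TT (Function.update (Function.update m0 i x) j w) =
      TTl (Function.update m0 i x) j w := fun _ _ => rfl
  have sloti : ∀ x w, TT (Function.update (Function.update m0 i x) j w) =
      TTl (Function.update m0 j w) i x := fun x w => by
    rw [Function.update_comm hij]; rfl
  have hQ0 : ∀ x, TT (Function.update (Function.update m0 i x) j 1) ∈ V := by
    intro x
    apply hQ
    intro k hk
    by_cases hkj : k = j
    · rw [hkj, Function.update_self]
    · rw [Function.update_of_ne hkj, Function.update_of_ne (fun h : k = i => hk (h ▸ hi)), hm0Q k hk]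
  have cA : ∀ x y w, TT (Function.update (Function.update m0 i (x * y - y * x)) j w) ∈ V := by
    intro x y w
    have := hV _ (hQ0 x) _ (hp y w)
    rw [prodl, prodr, one_mul, mul_one, sloti, sloti, ← map_sub] at this
    rwa [sloti]
  obtain ⟨x, y, hxy⟩ : ∃ x y : M2, (x * y - y * x) * (x * y - y * x) = 1 := by
    refine ⟨!![0, 1; 0, 0], !![0, 0; 1, 0], ?_⟩
    ext i j
    fin_cases i <;> fin_cases j <;> simp
  have cB : ∀ w w', TT (Function.update (Function.update m0 i 1) j (w * w' - w' * w)) ∈ V := by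
    intro w w'
    have := hV _ (cA x y w) _ (hp (x * y - y * x) w')
    rw [prodl, prodr, hxy, slotj, slotj, ← map_sub] at this
    rwa [slotj]
  have c1 : ∀ w, TT (Function.update (Function.update m0 i 1) j w) ∈ V := by
    intro w
    exact m2_comm (V.comap (TTl (Function.update m0 i 1) j)) (hQ0 1) cB w
  have c2 : ∀ x w, TT (Function.update (Function.update m0 i x) j w) ∈ V := by
    intro x w
    rw [sloti]
    refine m2_comm (V.comap (TTl (Function.update m0 j w) i)) ?_ ?_ x
    · have := c1 w; rwa [sloti] at this
    · intro x y; have := cA x y w; rwa [sloti] at this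
  have := c2 (m i) (m j)
  convert this using 2
  funext k
  by_cases hkj : k = j
  · subst hkj; simp
  · by_cases hki : k = i
    · subst hki; simp [hij]
    · simp [hkj, hki, hm0]

theorem CQ_univ (V : Submodule ℂ (NMatrix n)) (hV : ∀ X ∈ V, ∀ Y ∈ V, X * Y - Y * X ∈ V)
    (hn : 2 ≤ n) (t : Fin n)
    (hconn : ∀ Q : Finset (Fin n), t ∈ Q → Q ≠ Finset.univ → ∃ i ∈ Q, ∃ j, j ∉ Q ∧
      ∀ x w : M2, TT (Function.update (Function.update 1 i x) j w) ∈ V) :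
    CQ V Finset.univ := by
  have start : CQ V {t} := by
    obtain ⟨i, hi, j, hj, h⟩ := hconn {t} (by simp) (by
      intro h
      have := congrArg Finset.card h
      simp at this; omega)
    rw [Finset.mem_singleton] at hi
    subst hi
    intro m hm
    convert h (m i) 1 using 2
    funext k
    by_cases hkj : k = j
    · subst hkj; simp [hm _ hj]
    · by_cases hki : k = i
      · subst hki; simp [hkj]
      · simp [hkj, hki, hm k (by simpa using hki)]
  suffices H : ∀ d : ℕ, ∀ Q : Finset (Fin n), t ∈ Q → CQ V Q → Q.card + d = n →
      CQ V Finset.univ from H (n - 1) {t} (by simp) start (by simp; omega)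
  intro d
  induction d with
  | zero =>
    intro Q _ hQ hc
    have : Q = Finset.univ := by
      rw [← Finset.card_eq_iff_eq_univ]; simpa using hc
    rwa [← this]
  | succ d ih =>
    intro Q ht hQ hc
    obtain ⟨i, hi, j, hj, h⟩ := hconn Q ht (by
      intro h; rw [h] at hc; simp at hc)
    exact ih (insert j Q) (by simp [ht]) (CQ_step V hV hQ hi hj h) (by
      rw [Finset.card_insert_of_notMem hj]; omega)
end LG

namespace LG
variable {n : ℕ}

/-- partial derivatives -/
noncomputable def dps (a : QubitBasis n) : Der (QQ n) := MvPolynomial.pderiv (Sum.inl a)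
/-- partial derivatives -/
noncomputable def dph (a : QubitBasis n) : Der (QQ n) := MvPolynomial.pderiv (Sum.inr a)

theorem dps_ps (a b : QubitBasis n) : dps a (ps b) = if b = a then 1 else 0 := by
  simp [dps, ps, MvPolynomial.pderiv_X, Pi.single_apply]
theorem dps_ph (a b : QubitBasis n) : dps a (ph b) = 0 := by
  simp [dps, ph, MvPolynomial.pderiv_X]
theorem dph_ps (a b : QubitBasis n) : dph a (ps b) = 0 := by
  simp [dph, ps, MvPolynomial.pderiv_X]
theorem dph_ph (a b : QubitBasis n) : dph a (ph b) = if b = a then 1 else 0 := by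
  simp [dph, ph, MvPolynomial.pderiv_X, Pi.single_apply]

theorem DX_single (a b : QubitBasis n) :
    DX (Matrix.single a b 1) = ps b • dps a - ph a • dph b := by
  apply der_ext <;> intro c
  · simp only [DX_ps, Derivation.sub_apply, Derivation.smul_apply, dps_ps, dph_ps, Matrix.single_apply]
    by_cases h : a = c
    · subst h; simp [apply_ite]
    · simp [h, Ne.symm h]
  · simp only [DX_ph, Derivation.sub_apply, Derivation.smul_apply, dps_ph, dph_ph, Matrix.single_apply]
    by_cases h : b = c
    · subst h; simp [apply_ite]
    · simp [h, Ne.symm h]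

theorem EE_one_zero : (EE 1 0 : Der (QQ n)) = ∑ c, ps c • dps c := by
  apply der_ext <;> intro c
  · simp [EE_ps, der_sum, dps_ps]
  · simp [EE_ph, der_sum, dps_ph]

theorem EE_zero_one : (EE 0 1 : Der (QQ n)) = ∑ c, ph c • dph c := by
  apply der_ext <;> intro c
  · simp [EE_ps, der_sum, dph_ps]
  · simp [EE_ph, der_sum, dph_ph]

theorem full_of_LL {S : Set (Pt n)} (hI : Irr S) (hC : Cone S) (h0 : pt0 n ∈ S)
    (h : ∀ X, X ∈ LL S) (f : MvPolynomial (QQ n) ℂ) (hf : Van S f) : f = 0 := by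
  have hD : ∀ a b : QubitBasis n, Stab S (ps b • dps a - ph a • dph b) := by
    intro a b
    rw [← DX_single]; exact h _
  have nps : ¬ Van S (ps (fun _ => 0)) := fun hv => by
    have := hv _ h0
    simp [ps, pt0, ket0] at this
  have nph : ¬ Van S (ph (fun _ => 0)) := fun hv => by
    have := hv _ h0
    simp [ph, pt0, ket0] at this
  have ndot : ¬ Van S (∑ c : QubitBasis n, ps c * ph c) := fun hv => by
    have := hv _ h0
    simp [ps, ph, pt0, ket0] at this
  have g1 : ∀ a c : QubitBasis n, Stab S (ph c • dps a - ph a • dps c) := by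
    intro a c
    apply Stab.cancel hI _ nps
    have := ((hD a (fun _ => 0)).smul (ph c)).sub ((hD c (fun _ => 0)).smul (ph a))
    convert this using 1
    simp only [smul_sub, smul_smul]
    rw [mul_comm (ph a) (ph c), mul_comm (ph c) (ps _), mul_comm (ph a) (ps _)]
    abel
  have g2 : ∀ b d : QubitBasis n, Stab S (ps d • dph b - ps b • dph d) := by
    intro b d
    apply Stab.cancel hI _ nph
    have := ((hD (fun _ => 0) d).smul (ps b)).sub ((hD (fun _ => 0) b).smul (ps d))
    convert this using 1
    simp only [smul_sub, smul_smul]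
    rw [mul_comm (ps b) (ps d), mul_comm (ps d) (ph _), mul_comm (ps b) (ph _)]
    abel
  have k1 : ∀ a : QubitBasis n, Stab S (dps a) := by
    intro a
    apply Stab.cancel hI _ ndot
    have := (Stab.sum Finset.univ (fun c _ => (g1 a c).smul (ps c))).add
      ((EE_stab hC 1 0).smul (ph a))
    convert this using 1
    rw [EE_one_zero]
    simp only [smul_sub, smul_smul, Finset.sum_sub_distrib, Finset.sum_smul, Finset.smul_sum]
    simp only [mul_comm (ph a)]
    abel
  have k2 : ∀ a : QubitBasis n, Stab S (dph a) := by
    intro a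
    apply Stab.cancel hI _ ndot
    have := (Stab.sum Finset.univ (fun c _ => (g2 a c).smul (ph c))).add
      ((EE_stab hC 0 1).smul (ps a))
    convert this using 1
    rw [EE_zero_one]
    simp only [smul_sub, smul_smul, Finset.sum_sub_distrib, Finset.sum_smul, Finset.smul_sum]
    simp only [mul_comm (ps a), mul_comm (ps _) (ph _)]
    abel
  refine full_of_pderiv ⟨_, h0⟩ (fun i => ?_) f hf
  cases i with
  | inl a => exact k1 a
  | inr a => exact k2 a

theorem LL_of_CQ (V : Submodule ℂ (NMatrix n)) (h : CQ V Finset.univ) (X : NMatrix n) : X ∈ V := by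
  have : X = ∑ a, ∑ b, X a b • (Matrix.single a b 1 : NMatrix n) := by
    conv_lhs => rw [Matrix.matrix_eq_sum_single X]
    simp
  rw [this]
  refine Submodule.sum_mem _ fun a _ => Submodule.sum_mem _ fun b _ => Submodule.smul_mem _ _ ?_
  rw [← TT_single]
  exact h _ (fun i hi => absurd (Finset.mem_univ i) hi)

/-- crossing a cut along a path -/
theorem path_cross {m : ℕ} (qs : Fin (m + 1) → Fin n) (Q : Finset (Fin n)) (h0 : qs 0 ∉ Q)
    (h1 : qs (Fin.last m) ∈ Q) : ∃ l : Fin m, qs l.castSucc ∉ Q ∧ qs l.succ ∈ Q := by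
  by_contra hc
  push Not at hc
  have : ∀ l : Fin (m + 1), qs l ∉ Q := by
    intro l
    induction l using Fin.induction with
    | zero => exact h0
    | succ l ih => exact hc l ih
  exact this _ h1

theorem full_of_slice {R : ℕ} (A : Architecture n R) (hn : 2 ≤ n) {lo hi : ℕ}
    (hsl : IsCausalSlice A lo hi) {S : Set (Pt n)} (hI : Irr S) (hC : Cone S) (h0 : pt0 n ∈ S)
    (h : ∀ i : Fin R, lo ≤ (i : ℕ) → (i : ℕ) < hi → ∀ f, Van S f → Van (Orb (A i).1 S) f)
    (f : MvPolynomial (QQ n) ℂ) (hf : Van S f) : f = 0 := by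
  obtain ⟨t, ht⟩ := hsl
  refine full_of_LL hI hC h0 (LL_of_CQ _ (CQ_univ _ (fun X hX Y hY => LL_lie hX hY) hn t ?_)) f hf
  intro Q htQ hQ
  obtain ⟨q, hq⟩ : ∃ q, q ∉ Q := by
    by_contra hc
    push Not at hc
    exact hQ (Finset.eq_univ_iff_forall.mpr hc)
  obtain ⟨m, idx, qs, -, hr, hq0, hqt, hp⟩ := ht q
  obtain ⟨l, hl1, hl2⟩ := path_cross qs Q (hq0 ▸ hq) (hqt ▸ htQ)
  refine ⟨_, hl2, _, hl1, fun x w => ?_⟩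
  have hne : qs l.castSucc ≠ qs l.succ := fun he => hl1 (he ▸ hl2)
  have hA := (A (idx l)).2
  have hmem := embed_mem hC hA (h (idx l) (hr l).1 (hr l).2)
  obtain ⟨h1, h2⟩ := hp l
  rcases h1 with h1 | h1 <;> rcases h2 with h2 | h2
  · exact absurd (h1.trans h2.symm) hne
  · have := hmem (K2 w x)
    rw [embed_K2 hA, two] at this
    rw [h1, h2, Function.update_comm hA.symm]
    exact this
  · have := hmem (K2 x w)
    rw [embed_K2 hA, two] at this
    rw [h1, h2]
    exact this
  · exact absurd (h1.trans h2.symm) hne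

theorem chain {T L : ℕ} (hn : 2 ≤ n) (hT : T ≤ 2 ^ (n + 1)) (A : Architecture n (T * L))
    (hslices : ∀ s < T, IsCausalSlice A (s * L) ((s + 1) * L)) :
    Ind (OrbL (prs A) (S0 n)) T := by
  have key : ∀ s ≤ T, Ind (OrbL ((prs A).take (s * L)) (S0 n)) s := by
    intro s
    induction s with
    | zero => intro _; exact ind_zero (by simpa [OrbL] using ⟨_, S0_pt0⟩)
    | succ s ih =>
      intro hs
      have ih := ih (by omega)
      set S := OrbL ((prs A).take (s * L)) (S0 n) with hS
      set sl := ((prs A).drop (s * L)).take L with hsl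
      have hsplit : (prs A).take ((s + 1) * L) = (prs A).take (s * L) ++ sl := by
        rw [hsl, Nat.add_mul, one_mul, List.take_add]
      have hS' : OrbL ((prs A).take ((s + 1) * L)) (S0 n) = OrbL sl S := by
        rw [hsplit, orbL_append]
      rw [hS']
      have hne : ∀ p ∈ sl, p.1 ≠ p.2 := fun p hp =>
        prs_ne A p (List.mem_of_mem_drop (List.mem_of_mem_take hp))
      have hneS : ∀ p ∈ (prs A).take (s * L), p.1 ≠ p.2 := fun p hp =>
        prs_ne A p (List.mem_of_mem_take hp)
      have hI : Irr S := irr_orbL _ S0_irr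
      have hC : Cone S := orbL_cone S0_cone
      by_cases hex : ∃ f, Van S f ∧ ¬ Van (OrbL sl S) f
      · obtain ⟨f, hf, hf'⟩ := hex
        exact ind_step (orbL_sub hne S) (irr_orbL _ hI) f hf hf' ih
      · push Not at hex
        apply ind_full
        · intro f hf
          have hfS : Van S f := fun z hz => hf z (orbL_sub hne S hz)
          refine full_of_slice A hn (hslices s (by omega)) hI hC (orbL_sub hneS _ S0_pt0) ?_ f hfS
          intro i hi1 hi2 f hf z hz
          refine hex f hf z (orb_sub_orbL hne ?_ S hz)
          rw [hsl, List.mem_take_iff_getElem]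
          refine ⟨i - s * L, ?_, ?_⟩
          · simp [prs]
            rw [Nat.add_mul] at hi2
            omega
          · simp [prs, Nat.add_sub_cancel' hi1]
        · simp
          calc s + 1 ≤ T := hs
            _ ≤ 2 ^ (n + 1) := hT
            _ = _ := by ring
  have := key T le_rfl
  rwa [List.take_of_length_le (by simp [prs])] at this
end LG

namespace LG
variable {n : ℕ}

/-- row of a gate as a two-by-two matrix -/
def row (g : M4) (i : Fin 4) : M2 := fun a b => g i (pairIdx a b)

theorem row_ext {g h : M4} (H : ∀ i, row g i = row h i) : g = h := by
  ext i j
  obtain ⟨⟨a, b⟩, rfl⟩ := e4.surjective j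
  exact congrFun (congrFun (H i) a) b

theorem row_mul (V : M4) (k k' : M2) (i : Fin 4) :
    row (V * K2 k k') i = kᵀ * row V i * k' := by
  ext c d
  simp only [row, Matrix.mul_apply, Matrix.transpose_apply]
  rw [← e4.sum_comp, Fintype.sum_prod_type]
  simp only [← pairIdx_eq, K2_apply, Fin.sum_univ_two]
  ring

/-- normal form -/
def VV (θ : Fin 9 → ℂ) : M4 :=
  !![1, 0, 0, 1; θ 0, θ 1, 0, θ 2; 0, θ 3, 1, θ 4; θ 5, θ 6, θ 7, θ 8]

/-- genericity -/
noncomputable def del (g : M4) : ℂ := (row g 0).det *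
  (row g 1 * (row g 0).adjugate * row g 2 - row g 2 * (row g 0).adjugate * row g 1).det

theorem core2 (M1 M2' : M2) (h : (M1 * M2' - M2' * M1).det ≠ 0) :
    ∃ Q : M2, Q.det ≠ 0 ∧ (Q⁻¹ * M1 * Q) 1 0 = 0 ∧ (Q⁻¹ * M2' * Q) 0 0 = 0 ∧
      (Q⁻¹ * M2' * Q) 1 0 = 1 := by
  obtain ⟨a, ha⟩ := Module.End.exists_eigenvalue (Matrix.toLin' M1)
  obtain ⟨v, hv⟩ := ha.exists_hasEigenvector
  have hv0 := hv.2
  have hva : M1 *ᵥ v = a • v := by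
    have := hv.apply_eq_smul
    rwa [Matrix.toLin'_apply] at this
  set u := M2' *ᵥ v with hu
  set Q : M2 := Matrix.of (fun r c => if c = 0 then v r else u r) with hQ
  have hQw : ∀ w, Q *ᵥ w = w 0 • v + w 1 • u := by
    intro w
    ext r
    simp [hQ, Matrix.mulVec, dotProduct, Fin.sum_univ_two, mul_comm]
  have hdet : Q.det ≠ 0 := by
    intro h0
    obtain ⟨w, hw0, hw⟩ := Matrix.exists_mulVec_eq_zero_iff.mpr h0
    rw [hQw] at hw
    have hw1 : w 1 ≠ 0 := by
      intro h1
      rw [h1, zero_smul, add_zero] at hw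
      rcases smul_eq_zero.mp hw with h2 | h2
      · apply hw0; ext i; fin_cases i
        · exact h2
        · exact h1
      · exact hv0 h2
    have hub : u = (-(w 1)⁻¹ * w 0) • v := by
      have h3 : w 1 • u = -(w 0 • v) := by rw [eq_neg_iff_add_eq_zero, add_comm]; exact hw
      rw [← inv_smul_smul₀ hw1 u, h3, smul_neg, smul_smul, neg_mul, neg_smul]
    apply h
    apply Matrix.exists_mulVec_eq_zero_iff.mp
    refine ⟨v, hv0, ?_⟩
    rw [Matrix.sub_mulVec, ← Matrix.mulVec_mulVec, ← Matrix.mulVec_mulVec, ← hu, hub, hva,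
      Matrix.mulVec_smul, Matrix.mulVec_smul, hva, ← hu, hub, smul_smul, smul_smul]
    rw [← sub_smul, mul_comm a, sub_self, zero_smul]
  have hunit : IsUnit Q.det := isUnit_iff_ne_zero.mpr hdet
  have hcol : ∀ (M : M2) (r : Fin 2), (Q⁻¹ * M * Q) r 0 = (Q⁻¹ *ᵥ (M *ᵥ v)) r := by
    intro M r
    rw [Matrix.mulVec_mulVec]
    simp [hQ, Matrix.mul_apply, Matrix.mulVec, dotProduct, Fin.sum_univ_two]
  have hQv : Q⁻¹ *ᵥ v = ![1, 0] := by
    have : v = Q *ᵥ ![1, 0] := by rw [hQw]; simp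
    conv_lhs => rw [this]
    rw [Matrix.mulVec_mulVec, Matrix.nonsing_inv_mul _ hunit, Matrix.one_mulVec]
  have hQu : Q⁻¹ *ᵥ u = ![0, 1] := by
    have : u = Q *ᵥ ![0, 1] := by rw [hQw]; simp
    conv_lhs => rw [this]
    rw [Matrix.mulVec_mulVec, Matrix.nonsing_inv_mul _ hunit, Matrix.one_mulVec]
  refine ⟨Q, hdet, ?_, ?_, ?_⟩
  · rw [hcol, hva, Matrix.mulVec_smul, hQv]; simp
  · rw [hcol, ← hu, hQu]; simp
  · rw [hcol, ← hu, hQu]; simp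

theorem core (g : M4) (h : del g ≠ 0) :
    ∃ θ k k', Matrix.det k ≠ 0 ∧ Matrix.det k' ≠ 0 ∧ g = VV θ * K2 k k' := by
  have hd := left_ne_zero_of_mul h
  have hc := right_ne_zero_of_mul h
  set X0 := row g 0 with hX0
  have hu : IsUnit X0.det := isUnit_iff_ne_zero.mpr hd
  have hXX : X0⁻¹ * X0 = 1 := Matrix.nonsing_inv_mul _ hu
  have hXX' : X0 * X0⁻¹ = 1 := Matrix.mul_nonsing_inv _ hu
  have hadj : X0.adjugate = X0.det • X0⁻¹ := by
    rw [Matrix.inv_def, smul_smul, Ring.mul_inverse_cancel _ hu, one_smul]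
  have hcomm : ((row g 1 * X0⁻¹) * (row g 2 * X0⁻¹) - (row g 2 * X0⁻¹) * (row g 1 * X0⁻¹)).det
      ≠ 0 := by
    intro h0
    apply hc
    have : row g 1 * X0.adjugate * row g 2 - row g 2 * X0.adjugate * row g 1 =
      X0.det • (((row g 1 * X0⁻¹) * (row g 2 * X0⁻¹) - (row g 2 * X0⁻¹) * (row g 1 * X0⁻¹)) * X0)
        := by
      rw [sub_mul, hadj]
      simp only [mul_assoc, hXX, mul_one, Matrix.mul_smul, Matrix.smul_mul, smul_sub]
    rw [this, Matrix.det_smul, Matrix.det_mul, h0]; simp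
  obtain ⟨Q, hQ, h1, h2, h3⟩ := core2 _ _ hcomm
  have hQu : IsUnit Q.det := isUnit_iff_ne_zero.mpr hQ
  have hQQ : Q * Q⁻¹ = 1 := Matrix.mul_nonsing_inv _ hQu
  have hQQ' : Q⁻¹ * Q = 1 := Matrix.nonsing_inv_mul _ hQu
  set Y : Fin 4 → M2 := fun i => Q⁻¹ * (row g i * X0⁻¹) * Q with hY
  refine ⟨![Y 1 0 0, Y 1 0 1, Y 1 1 1, Y 2 0 1, Y 2 1 1, Y 3 0 0, Y 3 0 1, Y 3 1 0, Y 3 1 1],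
    Qᵀ, Q⁻¹ * X0, by simpa using hQ, ?_, ?_⟩
  · rw [Matrix.det_mul]
    refine mul_ne_zero ?_ hd
    intro h0
    have := congrArg Matrix.det hQQ
    rw [Matrix.det_mul, h0] at this
    simp at this
  · apply row_ext
    intro i
    rw [row_mul, Matrix.transpose_transpose]
    have hrow : row g i = Q * Y i * (Q⁻¹ * X0) := by
      simp only [hY, mul_assoc]
      rw [← mul_assoc Q Q⁻¹ X0, hQQ, one_mul, hXX, mul_one, ← mul_assoc, hQQ, one_mul]
    rw [hrow]
    congr 2
    have hY0 : Y 0 = 1 := by simp only [hY, ← hX0, hXX', mul_one, hQQ']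
    have e1 : Y 1 1 0 = 0 := h1
    have e2 : Y 2 0 0 = 0 := h2
    have e3 : Y 2 1 0 = 1 := h3
    ext a b
    fin_cases i <;> fin_cases a <;> fin_cases b <;>
      simp [row, VV, pairIdx, hY0, e1, e2, e3]

theorem del_ex : ∃ g : M4, del g ≠ 0 := by
  refine ⟨!![1, 0, 0, 1; 0, 1, 0, 0; 0, 0, 1, 0; 0, 0, 0, 0], ?_⟩
  have r0 : row !![1, 0, 0, 1; 0, 1, 0, 0; 0, 0, 1, 0; 0, 0, 0, 0] 0 = 1 := by
    ext a b; fin_cases a <;> fin_cases b <;> simp [row, pairIdx]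
  have r1 : row !![1, 0, 0, 1; 0, 1, 0, 0; 0, 0, 1, 0; 0, 0, 0, 0] 1 = !![0, 1; 0, 0] := by
    ext a b; fin_cases a <;> fin_cases b <;> simp [row, pairIdx]
  have r2 : row !![1, 0, 0, 1; 0, 1, 0, 0; 0, 0, 1, 0; 0, 0, 0, 0] 2 = !![0, 0; 1, 0] := by
    ext a b; fin_cases a <;> fin_cases b <;> simp [row, pairIdx]
  rw [del, r0, r1, r2]
  simp [Matrix.det_fin_two]

theorem del_poly (g : ℂ → M4) (hg : ∀ i j, (fun t => g t i j) ∈ PolyC) :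
    (fun t => del (g t)) ∈ PolyC := by
  have hr : ∀ k a b, (fun t => row (g t) k a b) ∈ PolyC := fun k a b => hg _ _
  have ha := mem_adj PolyC (fun t => row (g t) 0) (hr 0)
  refine mem_mul _ (mem_det _ _ (hr 0)) (mem_det _ _ fun i j => mem_sub _ ?_ ?_)
  · exact mem_matmul _ (fun t => row (g t) 1 * (row (g t) 0).adjugate) _
      (mem_matmul _ _ _ (hr 1) ha) (hr 2) i j
  · exact mem_matmul _ (fun t => row (g t) 2 * (row (g t) 0).adjugate) _
      (mem_matmul _ _ _ (hr 2) ha) (hr 1) i j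
end LG

namespace LG
variable {n : ℕ}

/-- product vector -/
noncomputable def tens (a : Fin n → Fin 2 → ℂ) : QubitBasis n → ℂ := fun q => ∏ i, a i (q i)

theorem TT_tens (m : Fin n → M2) (a : Fin n → Fin 2 → ℂ) :
    TT m *ᵥ tens a = tens (fun i => m i *ᵥ a i) := by
  ext q
  simp only [TT, tens, Matrix.mulVec, dotProduct, ← Finset.prod_mul_distrib]
  rw [Finset.prod_univ_sum]
  simp

/-- product point -/
noncomputable def wpt (c d : ℂ) (a b : Fin n → Fin 2 → ℂ) : Pt n :=
  Sum.elim (c • tens a) (d • tens b)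

/-- product states -/
def W0 (n : ℕ) : Set (Pt n) := {w | ∃ c d a b, w = wpt c d a b}

/-- invariance under local operations -/
def LInv (W : Set (Pt n)) : Prop := ∀ m m' : Fin n → M2, (∀ i, (m i)ᵀ * m' i = 1) →
  ∀ z ∈ W, act (TT m) (TT m') z ∈ W

theorem W0_inv : LInv (W0 n) := by
  rintro m m' - _ ⟨c, d, a, b, rfl⟩
  refine ⟨c, d, fun i => m i *ᵥ a i, fun i => m' i *ᵥ b i, ?_⟩
  rw [wpt, wpt, ← TT_tens, ← TT_tens]
  ext i; cases i <;> simp [act, Matrix.mulVec_smul]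

theorem W0_cone : Cone (W0 n) := by
  rintro _ ⟨c, d, a, b, rfl⟩ c' d'
  refine ⟨c' * c, d' * d, a, b, ?_⟩
  ext i; cases i <;> simp [act, wpt, mul_assoc, Matrix.smul_mulVec]

theorem W0_pt0 : pt0 n ∈ W0 n := by
  refine ⟨1, 1, fun _ => ![1, 0], fun _ => ![1, 0], ?_⟩
  have : ket0 n = tens (fun _ => ![1, 0]) := by
    ext q
    rw [ket0, tens]
    split
    · next h => subst h; simp
    · next h =>
      obtain ⟨i, hi⟩ := Function.ne_iff.mp h
      rw [eq_comm]
      refine Finset.prod_eq_zero (Finset.mem_univ i) ?_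
      have : q i = 1 := by omega
      rw [this]; simp
  rw [pt0, wpt, one_smul, ← this]

theorem adj_K2 {k k' l l' : M2} (h : kᵀ * l = 1) (h' : k'ᵀ * l' = 1) :
    (K2 k k').adjugateᵀ = (K2 k k').det • K2 l l' := by
  have h1 : (K2 k k')ᵀ * K2 l l' = 1 := by rw [K2_transpose, K2_mul, h, h', K2_one]
  have h2 : (K2 l l')ᵀ * K2 k k' = 1 := by
    have := congrArg Matrix.transpose h1
    simpa using this
  have h3 : (K2 k k').adjugate = (K2 k k').det • (K2 l l')ᵀ := by
    calc (K2 k k').adjugate = ((K2 l l')ᵀ * K2 k k') * (K2 k k').adjugate := by rw [h2, one_mul]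
      _ = _ := by rw [mul_assoc, Matrix.mul_adjugate]; simp
  rw [h3]; simp

theorem orb_inv {p : Fin n × Fin n} (hp : p.1 ≠ p.2) {W : Set (Pt n)} (hC : Cone W)
    (hW : LInv W) : LInv (Orb p W) := by
  rintro m m' hm _ ⟨g, z, hz, rfl⟩
  set K := K2 (m p.1) (m p.2) with hK
  set K' := K2 (m' p.1) (m' p.2) with hK'
  set m1 := Function.update (Function.update m p.1 1) p.2 1 with hm1
  set m1' := Function.update (Function.update m' p.1 1) p.2 1 with hm1'
  have ha : (K).adjugateᵀ = K.det • K' := adj_K2 (hm _) (hm _)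
  have hdK : K.det ≠ 0 := by
    have h1 : Kᵀ * K' = 1 := by rw [K2_transpose, K2_mul, hm, hm, K2_one]
    intro h0
    have := congrArg Matrix.det h1
    rw [Matrix.det_mul, Matrix.det_transpose, h0] at this
    simp at this
  have hz' : act (TT m1) (TT m1') z ∈ W := by
    apply hW _ _ _ _ hz
    intro i
    rw [hm1, hm1']
    by_cases h2 : i = p.2
    · subst h2; simp
    · by_cases h1 : i = p.1
      · subst h1; simp [h2]
      · simp [h1, h2, hm]
  refine ⟨K * g, _, hC _ hz' 1 (K.det⁻¹), ?_⟩
  have e1 : TT m * embedGate p g = embedGate p (K * g) * TT m1 := by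
    rw [TT_split hp m, mul_assoc, embed_comm hp m1 (by simp [hm1, hp]) (by simp [hm1]),
      ← mul_assoc, ← embed_mul hp]
  have e2 : TT m' * embedGate p g.adjugateᵀ = embedGate p (K' * g.adjugateᵀ) * TT m1' := by
    rw [TT_split hp m', mul_assoc, embed_comm hp m1' (by simp [hm1', hp]) (by simp [hm1']),
      ← mul_assoc, ← embed_mul hp]
  rw [act_act, e1, e2, act_act, act_act, Matrix.adjugate_mul_distrib, Matrix.transpose_mul, ha]
  congr 1
  · simp
  · rw [Matrix.smul_mul, embed_smul]
    simp [smul_smul, hdK]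

/-- parametrisation by `k` parameters -/
def Par (W : Set (Pt n)) (k : ℕ) : Prop := ∃ (σ : Type) (_ : Fintype σ), Fintype.card σ = k ∧
  ∃ Φ : (σ → ℂ) → Pt n, (∀ i, (fun t => Φ t i) ∈ PolyM σ) ∧
    ∀ f : MvPolynomial (QQ n) ℂ, (∀ t, MvPolynomial.eval (Φ t) f = 0) → Van W f

theorem polyM_comp {σ σ' : Type} (e : σ → σ') {F : (σ → ℂ) → ℂ} (h : F ∈ PolyM σ) :
    (fun t : σ' → ℂ => F (fun s => t (e s))) ∈ PolyM σ' := by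
  obtain ⟨p, hp⟩ := polyM_iff h
  simp only [hp]
  exact mem_eval _ p _ (fun i => polyM_X (e i))

theorem par_orb {p : Fin n × Fin n} (hp : p.1 ≠ p.2) {W : Set (Pt n)} (hC : Cone W)
    (hW : LInv W) {k : ℕ} (h : Par W k) : Par (Orb p W) (k + 9) := by
  obtain ⟨σ, _, hcard, Φ, hΦ, hv⟩ := h
  refine ⟨σ ⊕ Fin 9, inferInstance, by simp [hcard], fun t =>
    act (embedGate p (VV (fun s => t (Sum.inr s)))) (embedGate p (VV (fun s => t (Sum.inr s))).adjugateᵀ)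
      (Φ (fun s => t (Sum.inl s))), ?_, ?_⟩
  · have hV : ∀ i j, (fun t : σ ⊕ Fin 9 → ℂ => VV (fun s => t (Sum.inr s)) i j) ∈ PolyM (σ ⊕ Fin 9) := by
      intro i j
      fin_cases i <;> fin_cases j <;> first | exact polyM_X _ | exact mem_const _ _
    exact mem_act _ _ _ _ (mem_embed _ p _ hV)
      (mem_embed _ p _ (fun i j => mem_adj _ _ hV j i)) (fun i => polyM_comp Sum.inl (hΦ i))
  · intro f hf
    have h1 : ∀ θ, ∀ z ∈ W,
        MvPolynomial.eval (act (embedGate p (VV θ)) (embedGate p (VV θ).adjugateᵀ) z) f = 0 := by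
      intro θ z hz
      obtain ⟨f', hf'⟩ := pull (embedGate p (VV θ)) (embedGate p (VV θ).adjugateᵀ) f
      rw [← hf']
      refine hv f' (fun t => ?_) z hz
      rw [hf']
      exact hf (Sum.elim t θ)
    have h2 : ∀ g, del g ≠ 0 → ∀ z ∈ W,
        MvPolynomial.eval (act (embedGate p g) (embedGate p g.adjugateᵀ) z) f = 0 := by
      intro g hg z hz
      obtain ⟨θ, k, k', hk, hk', rfl⟩ := core g hg
      have hkk : ∀ k : M2, k.det ≠ 0 → kᵀ * (k⁻¹)ᵀ = 1 := by
        intro k hk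
        rw [← Matrix.transpose_mul, Matrix.nonsing_inv_mul _ (isUnit_iff_ne_zero.mpr hk),
          Matrix.transpose_one]
      rw [Matrix.adjugate_mul_distrib, Matrix.transpose_mul, adj_K2 (hkk k hk) (hkk k' hk'),
        embed_mul hp, embed_mul hp, ← act_act]
      refine h1 θ _ ?_
      rw [embed_smul, embed_K2 hp, embed_K2 hp]
      have := hC _ (hW (two p k k') (two p (k⁻¹)ᵀ (k'⁻¹)ᵀ) (fun i => by
        by_cases h1 : i = p.1
        · subst h1; rw [two_fst hp, two_fst hp, hkk k hk]
        · by_cases h2 : i = p.2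
          · subst h2; rw [two_snd, two_snd, hkk k' hk']
          · rw [two_other _ _ h1 h2, two_other _ _ h1 h2]; simp) z hz) 1 (K2 k k').det
      rwa [← act_smul', one_smul] at this
    rintro _ ⟨g, z, hz, rfl⟩
    obtain ⟨g0, hg0⟩ := del_ex
    set gt : ℂ → M4 := fun t => g + t • (g0 - g) with hgt
    have hgp : ∀ i j, (fun t => gt t i j) ∈ PolyC := fun i j =>
      mem_add _ (mem_const _ _) (mem_mul _ polyC_id (mem_const _ _))
    have hP : (fun t => MvPolynomial.eval
        (act (embedGate p (gt t)) (embedGate p ((gt t).adjugateᵀ)) z) f) ∈ PolyC :=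
      mem_eval _ f _ (mem_act _ _ _ _ (mem_embed _ p _ hgp)
        (mem_embed _ p _ (fun i j => mem_adj _ _ hgp j i)) (fun i => mem_const _ _))
    have := polyC_cancel hP (del_poly gt hgp) 1 (by simpa [hgt] using hg0)
      (fun t ht => h2 _ ht z hz) 0
    simpa [hgt] using this

theorem mem_wpt {T : Type} (𝒜 : Subalgebra ℂ (T → ℂ)) (c d : T → ℂ) (a b : T → Fin n → Fin 2 → ℂ)
    (hc : c ∈ 𝒜) (hd : d ∈ 𝒜) (ha : ∀ i j, (fun t => a t i j) ∈ 𝒜)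
    (hb : ∀ i j, (fun t => b t i j) ∈ 𝒜) (i : QQ n) :
    (fun t => wpt (c t) (d t) (a t) (b t) i) ∈ 𝒜 := by
  cases i with
  | inl q => exact mem_mul 𝒜 hc (mem_prod 𝒜 _ _ fun i _ => ha i _)
  | inr q => exact mem_mul 𝒜 hd (mem_prod 𝒜 _ _ fun i _ => hb i _)

theorem tens_norm (a : Fin n → Fin 2 → ℂ) (h : ∏ i, a i 0 ≠ 0) :
    tens a = (∏ i, a i 0) • tens (fun i => ![1, a i 1 / a i 0]) := by
  ext q
  simp only [tens, Pi.smul_apply, smul_eq_mul, ← Finset.prod_mul_distrib]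
  refine Finset.prod_congr rfl fun i _ => ?_
  have : a i 0 ≠ 0 := fun h0 => h (Finset.prod_eq_zero (Finset.mem_univ i) h0)
  generalize q i = x
  fin_cases x
  · simp
  · simp; field_simp

theorem par_W0 : Par (W0 n) (2 * n + 2) := by
  refine ⟨Fin 2 ⊕ (Fin n ⊕ Fin n), inferInstance, by simp; ring, fun t =>
    wpt (t (Sum.inl 0)) (t (Sum.inl 1)) (fun i => ![1, t (Sum.inr (Sum.inl i))])
      (fun i => ![1, t (Sum.inr (Sum.inr i))]), ?_, ?_⟩
  · refine mem_wpt _ _ _ _ _ (polyM_X _) (polyM_X _) ?_ ?_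
    all_goals
      intro i j
      fin_cases j
      · exact mem_const _ _
      · exact polyM_X _
  · rintro f hf _ ⟨c, d, a, b, rfl⟩
    have h1 : ∀ a b : Fin n → Fin 2 → ℂ, (∏ i, a i 0) * (∏ i, b i 0) ≠ 0 →
        MvPolynomial.eval (wpt c d a b) f = 0 := by
      intro a b hab
      have := hf (Sum.elim ![c * ∏ i, a i 0, d * ∏ i, b i 0]
        (Sum.elim (fun i => a i 1 / a i 0) (fun i => b i 1 / b i 0)))
      convert this using 3
      simp only [wpt, Sum.elim_inl, Sum.elim_inr, Matrix.cons_val_zero, Matrix.cons_val_one, mul_smul,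
        ← tens_norm a (left_ne_zero_of_mul hab), ← tens_norm b (right_ne_zero_of_mul hab)]
    have hl : ∀ x : Fin n → Fin 2 → ℂ, ∀ i j,
        (fun t : ℂ => (x + t • (1 - x)) i j) ∈ PolyC := fun x i j =>
      mem_add _ (mem_const _ _) (mem_mul _ polyC_id (mem_const _ _))
    have := polyC_cancel
      (F := fun t => MvPolynomial.eval (wpt c d (a + t • (1 - a)) (b + t • (1 - b))) f)
      (G := fun t => (∏ i, (a + t • (1 - a)) i 0) * (∏ i, (b + t • (1 - b)) i 0))
      (mem_eval _ f _ (mem_wpt _ _ _ _ _ (mem_const _ _) (mem_const _ _) (hl a) (hl b)))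
      (mem_mul _ (mem_prod _ _ _ fun i _ => hl a i 0) (mem_prod _ _ _ fun i _ => hl b i 0)) 1
      (by simp) (fun t ht => h1 _ _ ht) 0
    simpa using this

theorem par_orbL {l : List (Fin n × Fin n)} (hl : ∀ p ∈ l, p.1 ≠ p.2) {W : Set (Pt n)}
    (hC : Cone W) (hW : LInv W) {k : ℕ} (h : Par W k) : Par (OrbL l W) (k + 9 * l.length) := by
  induction l generalizing W k with
  | nil => simpa [OrbL] using h
  | cons p l ih =>
    have hp := hl p (by simp)
    have := ih (fun q hq => hl q (by simp [hq])) (orb_cone hC) (orb_inv hp hC hW)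
      (par_orb hp hC hW h)
    rw [List.length_cons, show k + 9 * (l.length + 1) = k + 9 + 9 * l.length by ring]
    exact this

theorem upper {R : ℕ} (A : Architecture n R) {k : ℕ} (h : Ind (OrbL (prs A) (W0 n)) k) :
    k ≤ 9 * R + 2 * n + 2 := by
  obtain ⟨σ, _, hc, Φ, hΦ, hv⟩ := par_orbL (prs_ne A) W0_cone W0_inv par_W0
  have := ind_bound' h Φ hΦ hv
  rw [hc] at this
  simp [prs] at this
  omega
end LG

namespace LG
variable {n : ℕ}

/-- the point associated to gates -/
noncomputable def PA {R : ℕ} (A : Architecture n R) (g : Fin R → M4) : Pt n :=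
  act (contr A g) (contr A (fun i => (g i).adjugateᵀ)) (pt0 n)

theorem adj_SU4 (y : SU4) : ((y : M4).adjugate)ᵀ = (y : M4).map star := by
  have h := Matrix.mem_specialUnitaryGroup_iff.mp y.2
  have h1 : (y : M4) * star (y : M4) = 1 := h.1.2
  have : (y : M4).adjugate = star (y : M4) := by
    calc (y : M4).adjugate = (y : M4).adjugate * ((y : M4) * star (y : M4)) := by rw [h1, mul_one]
      _ = _ := by rw [← mul_assoc, Matrix.adjugate_mul, h.2, one_smul, one_mul]
  rw [this]; rfl

theorem contr_conj {R : ℕ} (A : Architecture n R) (g : Fin R → M4) :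
    contr A (fun i => (g i).map (starRingEnd ℂ)) = (contr A g).map (starRingEnd ℂ) := by
  induction R with
  | zero => simp [contr]
  | succ R ih =>
    rw [contr_succ, contr_succ, ih, Matrix.map_mul]
    congr 1
    ext i j
    simp only [embedGate, Matrix.map_apply]
    split <;> simp

theorem PA_SU4 {R : ℕ} (A : Architecture n R) (x : Fin R → SU4) :
    PA A (fun i => (x i : M4)) = Sum.elim (contract A x *ᵥ ket0 n)
      (fun i => starRingEnd ℂ ((contract A x *ᵥ ket0 n) i)) := by
  rw [PA]
  have : (fun i => ((x i : M4).adjugate)ᵀ) = fun i => (x i : M4).map (starRingEnd ℂ) := by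
    funext i; exact adj_SU4 _
  rw [this, contr_conj, contract_eq]
  ext i
  cases i with
  | inl i => simp [act, pt0]
  | inr i =>
    simp only [act, pt0, Sum.elim_inr, Matrix.mulVec, dotProduct, map_sum, map_mul]
    refine Finset.sum_congr rfl fun j _ => ?_
    simp only [Matrix.map_apply, Function.comp, Sum.elim_inr, ket0]
    split <;> simp

theorem PA_mem {R R' : ℕ} (A : Architecture n R) (x : Fin R → SU4) (A' : Architecture n R')
    (y : Fin R' → SU4) (h : contract A' y *ᵥ ket0 n = contract A x *ᵥ ket0 n) :
    PA A (fun i => (x i : M4)) ∈ OrbL (prs A') (W0 n) := by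
  rw [PA_SU4, ← h, ← PA_SU4, mem_orbL_prs]
  exact ⟨_, _, W0_pt0, rfl⟩

theorem ind_transfer {ι : Type} {S S' : Set (ι → ℂ)} {k : ℕ} (h : Ind S k)
    (hv : ∀ f, Van S' f → Van S f) : Ind S' k := by
  obtain ⟨q, hq⟩ := h
  refine ⟨q, fun F hF => ?_⟩
  by_contra hc
  push Not at hc
  obtain ⟨z, hz, h0⟩ := hq F hF
  have := hv (MvPolynomial.aeval q F) (fun z hz => by rw [eval_aev]; exact hc z hz) z hz
  rw [eval_aev] at this
  exact h0 this

/-- conical vanishing -/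
def VV' {R : ℕ} (A : Architecture n R) (f : MvPolynomial (QubitBasis n ⊕ QubitBasis n) ℂ)
    (g : Fin R → M4) : Prop :=
  ∀ c d : ℂ, MvPolynomial.eval (act (c • 1) (d • 1) (PA A g)) f = 0

theorem exists_sep {T L R' : ℕ} (hn : 2 ≤ n) (hT : T ≤ 2 ^ (n + 1))
    (A : Architecture n (T * L))
    (hslices : ∀ s < T, IsCausalSlice A (s * L) ((s + 1) * L)) (A' : Architecture n R')
    (hR : 9 * R' + 2 * n + 2 < T) :
    ∃ f : MvPolynomial (QubitBasis n ⊕ QubitBasis n) ℂ,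
      Van (OrbL (prs A') (W0 n)) f ∧ ∃ g, ¬ VV' A f g := by
  by_contra hc
  push Not at hc
  have h1 : Ind (OrbL (prs A') (W0 n)) T := by
    refine ind_transfer (chain hn hT A hslices) fun f hf => ?_
    intro w hw
    rw [mem_orbL_prs] at hw
    obtain ⟨g, _, ⟨c, d, rfl⟩, rfl⟩ := hw
    have := hc f hf g c d
    rwa [PA, ← act_smul', act_smul] at this
  have := upper A' h1
  omega

theorem contr_smul {R : ℕ} (A : Architecture n R) (g : Fin R → M4) (s : Fin R → ℂ) :
    contr A (fun i => s i • g i) = (∏ i, s i) • contr A g := by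
  induction R with
  | zero => simp [contr]
  | succ R ih =>
    rw [contr_succ, contr_succ, ih (tl A) (fun i => g i.succ) (fun i => s i.succ), embed_smul, Fin.prod_univ_succ]
    simp [smul_smul, mul_comm]

theorem VV'_smul {R : ℕ} (A : Architecture n R) (f : MvPolynomial (QubitBasis n ⊕ QubitBasis n) ℂ)
    (g : Fin R → M4) (s : Fin R → ℂ) (h : VV' A f g) : VV' A f (fun i => s i • g i) := by
  intro c d
  have : (fun i => ((s i • g i).adjugate)ᵀ) = fun i => (s i) ^ 3 • ((g i).adjugate)ᵀ := by
    funext i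
    rw [Matrix.adjugate_smul, Matrix.transpose_smul]; simp
  rw [PA, this, contr_smul, contr_smul A _ (fun i => s i ^ 3), act_act]
  have := h (c * ∏ i, s i) (d * ∏ i, s i ^ 3)
  rw [PA, act_act] at this
  simpa [smul_smul, mul_comm] using this

theorem mem_contr {T : Type} (𝒜 : Subalgebra ℂ (T → ℂ)) {R : ℕ} (A : Architecture n R)
    (g : T → Fin R → M4) (hg : ∀ k i j, (fun t => g t k i j) ∈ 𝒜) (i j : QubitBasis n) :
    (fun t => contr A (g t) i j) ∈ 𝒜 := by
  induction R generalizing i j with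
  | zero =>
    have : ∀ t, contr A (g t) = 1 := fun t => by simp [contr]
    simp only [this]
    exact mem_const _ _
  | succ R ih =>
    simp only [contr_succ]
    exact mem_matmul _ _ _ (ih (tl A) (fun t i => g t i.succ) (fun k => hg k.succ))
      (mem_embed _ _ _ (hg 0)) i j

theorem mem_fPA {T : Type} (𝒜 : Subalgebra ℂ (T → ℂ)) {R : ℕ} (A : Architecture n R)
    (f : MvPolynomial (QubitBasis n ⊕ QubitBasis n) ℂ) (c d : ℂ)
    (g : T → Fin R → M4) (hg : ∀ k i j, (fun t => g t k i j) ∈ 𝒜) :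
    (fun t => MvPolynomial.eval (act (c • 1) (d • 1) (PA A (g t))) f) ∈ 𝒜 := by
  refine mem_eval _ _ _ (mem_act _ (fun _ => c • 1) (fun _ => d • 1) (fun t => PA A (g t))
    (fun _ _ => mem_const _ _) (fun _ _ => mem_const _ _) ?_)
  refine mem_act _ _ _ (fun _ => pt0 n) (mem_contr _ A g hg) ?_ (fun _ => mem_const _ _)
  exact mem_contr _ A (fun t i => ((g t i).adjugate)ᵀ) (fun k i j => mem_adj _ _ (hg k) j i)

end LG

namespace LG
variable {n : ℕ}

/-- polynomial Cayley -/
noncomputable def BB (K : M4) : M4 := (1 + K) * (1 - K).adjugate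

theorem cay_SU4 (K : M4) (hK : Kᴴ = -K) : ∃ u : SU4, ∃ β : ℂ, β ≠ 0 ∧ BB K = β • (u : M4) := by
  have hD : (1 - K)ᴴ = 1 + K := by simp [hK]
  have hdet : (1 - K).det ≠ 0 := by
    have h1 : (1 + K) * (1 - K) = 1 + Kᴴ * K := by rw [hK]; noncomm_ring
    have h2 : (1 + Kᴴ * K).PosDef :=
      Matrix.PosDef.one.add_posSemidef (Matrix.posSemidef_conjTranspose_mul_self K)
    have h3 := h2.det_pos
    rw [← h1, Matrix.det_mul] at h3
    intro h0
    rw [h0, mul_zero] at h3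
    exact lt_irrefl _ h3
  have hu : IsUnit (1 - K).det := isUnit_iff_ne_zero.mpr hdet
  obtain ⟨U, hU⟩ : ∃ U, U = (1 + K) * (1 - K)⁻¹ := ⟨_, rfl⟩
  have hUB : BB K = (1 - K).det • U := by
    rw [BB, hU, Matrix.inv_def, Matrix.mul_smul, smul_smul, Ring.mul_inverse_cancel _ hu, one_smul]
  have hdet' : (1 + K).det ≠ 0 := by
    rw [← hD, Matrix.det_conjTranspose]; simpa using hdet
  have hu' : IsUnit (1 + K).det := isUnit_iff_ne_zero.mpr hdet'
  have hUU : Uᴴ * U = 1 := by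
    have h1 : ((1 - K)⁻¹)ᴴ = (1 + K)⁻¹ := by rw [Matrix.conjTranspose_nonsing_inv, hD]
    have h2 : (1 + K)ᴴ = 1 - K := by simp [hK, sub_eq_add_neg]
    rw [hU, Matrix.conjTranspose_mul, h1, h2]
    have h3 : (1 - K) * (1 + K) = (1 + K) * (1 - K) := by noncomm_ring
    calc (1 + K)⁻¹ * (1 - K) * ((1 + K) * (1 - K)⁻¹)
        = (1 + K)⁻¹ * ((1 - K) * (1 + K)) * (1 - K)⁻¹ := by noncomm_ring
      _ = ((1 + K)⁻¹ * (1 + K)) * ((1 - K) * (1 - K)⁻¹) := by rw [h3]; noncomm_ring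
      _ = 1 := by rw [Matrix.nonsing_inv_mul _ hu', Matrix.mul_nonsing_inv _ hu, one_mul]
  have hn : star U.det * U.det = 1 := by
    have := congrArg Matrix.det hUU
    rwa [Matrix.det_mul, Matrix.det_conjTranspose, Matrix.det_one] at this
  have hU0 : U.det ≠ 0 := right_ne_zero_of_mul_eq_one hn
  have hnorm : ‖U.det‖ = 1 := by
    have := congrArg norm hn
    rw [norm_mul, norm_star, norm_one] at this
    nlinarith [norm_nonneg U.det]
  obtain ⟨c, hc⟩ := IsAlgClosed.exists_pow_nat_eq (U.det)⁻¹ (n := 4) (by norm_num)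
  have hc1 : ‖c‖ = 1 := by
    have := congrArg norm hc
    rw [norm_pow, norm_inv, hnorm, inv_one] at this
    exact (pow_eq_one_iff_of_nonneg (norm_nonneg _) (by norm_num)).mp this
  have hcc : star c * c = 1 := by
    have := Complex.conj_mul' c
    rw [hc1] at this
    simpa using this
  have hc0 : c ≠ 0 := right_ne_zero_of_mul_eq_one hcc
  have hV : (c • U)ᴴ * (c • U) = 1 := by
    rw [Matrix.conjTranspose_smul, Matrix.smul_mul, Matrix.mul_smul, smul_smul, hcc, one_smul, hUU]
  refine ⟨⟨c • U, Matrix.mem_specialUnitaryGroup_iff.mpr ⟨⟨hV, ?_⟩, ?_⟩⟩, (1 - K).det * c⁻¹,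
    mul_ne_zero hdet (inv_ne_zero hc0), ?_⟩
  · exact mul_eq_one_comm.mp hV
  · rw [Matrix.det_smul, Fintype.card_fin, hc, inv_mul_cancel₀ hU0]
  · rw [hUB]
    simp only [smul_smul]
    rw [mul_assoc, inv_mul_cancel₀ hc0, mul_one]

theorem BB_inv (G : M4) (h : (G + 1).det ≠ 0) : ∃ K : M4, ∃ β : ℂ, β ≠ 0 ∧ G = β • BB K := by
  have hu : IsUnit (G + 1).det := isUnit_iff_ne_zero.mpr h
  have e0 := Matrix.mul_nonsing_inv _ hu
  have e1 := Matrix.nonsing_inv_mul _ hu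
  set J := (G + 1)⁻¹ with hJ
  have e2 : G * J = 1 - J := by rw [add_mul, one_mul] at e0; exact eq_sub_of_add_eq e0
  have h1 : 1 - (G - 1) * J = (2 : ℂ) • J := by
    rw [sub_mul, one_mul, e2, two_smul]; abel
  have h2 : 1 + (G - 1) * J = (2 : ℂ) • (G * J) := by
    rw [sub_mul, one_mul, e2, two_smul]; abel
  have hJd : J.det ≠ 0 := by
    have := congrArg Matrix.det e0
    rw [Matrix.det_mul, Matrix.det_one] at this
    exact right_ne_zero_of_mul_eq_one this
  have h3 : BB ((G - 1) * J) = (16 * J.det) • G := by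
    rw [BB, h1, h2, Matrix.adjugate_smul, Matrix.smul_mul, Matrix.mul_smul, mul_assoc,
      Matrix.mul_adjugate, Matrix.mul_smul, smul_smul, smul_smul, mul_one]
    norm_num
  refine ⟨(G - 1) * J, (16 * J.det)⁻¹, by simp [hJd], ?_⟩
  rw [h3, smul_smul, inv_mul_cancel₀ (by simp [hJd]), one_smul]

theorem mem_BB {T : Type} (𝒜 : Subalgebra ℂ (T → ℂ)) (K : T → M4)
    (h : ∀ i j, (fun t => K t i j) ∈ 𝒜) (i j : Fin 4) : (fun t => BB (K t) i j) ∈ 𝒜 :=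
  mem_matmul 𝒜 _ _ (fun i j => mem_add 𝒜 (mem_const 𝒜 _) (h i j))
    (mem_adj 𝒜 _ (fun i j => mem_sub 𝒜 (mem_const 𝒜 _) (h i j))) i j

/-- shifted polynomial function -/
noncomputable def QQs {R : ℕ} (A : Architecture n R)
    (f : MvPolynomial (QubitBasis n ⊕ QubitBasis n) ℂ) (c d : ℂ) (x : Fin R → M4)
    (K : Fin R → M4) : ℂ :=
  MvPolynomial.eval (act (c • 1) (d • 1) (PA A (fun i => BB (K i) * x i))) f

theorem mem_QQs {T : Type} (𝒜 : Subalgebra ℂ (T → ℂ)) {R : ℕ} (A : Architecture n R)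
    (f : MvPolynomial (QubitBasis n ⊕ QubitBasis n) ℂ) (c d : ℂ) (x : T → Fin R → M4)
    (K : T → Fin R → M4) (hx : ∀ k i j, (fun t => x t k i j) ∈ 𝒜)
    (hK : ∀ k i j, (fun t => K t k i j) ∈ 𝒜) : (fun t => QQs A f c d (x t) (K t)) ∈ 𝒜 :=
  mem_fPA 𝒜 A f c d _ fun k => mem_matmul 𝒜 _ _ (mem_BB 𝒜 _ (hK k)) (hx k)

theorem exists_skew {R : ℕ} (A : Architecture n R)
    (f : MvPolynomial (QubitBasis n ⊕ QubitBasis n) ℂ) (x : Fin R → SU4) (g : Fin R → M4)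
    (hg : ¬ VV' A f g) :
    ∃ K : Fin R → M4, (∀ i, (K i)ᴴ = - K i) ∧ ∃ c d, QQs A f c d (fun i => (x i : M4)) K ≠ 0 := by
  by_contra hc
  push Not at hc
  have lin : ∀ (a b : Fin R → M4) (k : Fin R) (i j : Fin 4),
      (fun t : ℂ => (a k + t • b k) i j) ∈ PolyC := fun a b k i j =>
    mem_add _ (mem_const _ _) (mem_mul _ polyC_id (mem_const _ _))
  have h1 : ∀ c d K, QQs A f c d (fun i => (x i : M4)) K = 0 := by
    intro c d K
    let S1 : Fin R → M4 := fun i => (1 / 2 : ℂ) • (K i - (K i)ᴴ)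
    let S2 : Fin R → M4 := fun i => (-Complex.I / 2 : ℂ) • (K i + (K i)ᴴ)
    have hp := mem_QQs PolyC A f c d (fun _ i => (x i : M4)) (fun t i => S1 i + t • S2 i)
      (fun _ _ _ => mem_const _ _) (lin S1 S2)
    have := polyC_zero_of_infinite hp (Set.range ((↑) : ℝ → ℂ))
      (Set.infinite_range_of_injective Complex.ofReal_injective) (by
        rintro _ ⟨t, rfl⟩
        refine hc _ (fun i => ?_) c d
        simp only [S1, S2, Matrix.conjTranspose_add, Matrix.conjTranspose_smul,
          Matrix.conjTranspose_sub, Matrix.conjTranspose_conjTranspose]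
        ext a b
        simp
        ring) Complex.I
    convert this using 2
    funext i
    ext a b
    simp only [S1, S2, Matrix.add_apply, Matrix.smul_apply, Matrix.sub_apply, smul_eq_mul]
    linear_combination (-(1 / 2 : ℂ) * (K i a b + (K i)ᴴ a b)) * (-Complex.I_sq)
  have h2 : ∀ G : Fin R → M4, (∏ i, (G i + 1).det) ≠ 0 →
      VV' A f (fun i => G i * (x i : M4)) := by
    intro G hG
    have : ∀ i, ∃ K : M4, ∃ β : ℂ, β ≠ 0 ∧ G i = β • BB K := fun i =>
      BB_inv _ (Finset.prod_ne_zero_iff.mp hG i (Finset.mem_univ i))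
    choose K β hβ hK using this
    have h3 : VV' A f (fun i => BB (K i) * (x i : M4)) := fun c d => h1 c d K
    have := VV'_smul A f _ β h3
    convert this using 3 with i
    rw [hK, Matrix.smul_mul]
  have h4 : ∀ G : Fin R → M4, VV' A f (fun i => G i * (x i : M4)) := by
    intro G c d
    have hp := mem_fPA PolyC A f c d (fun t i => (0 + t • G i) * (x i : M4))
      (fun k => mem_matmul _ _ _ (lin 0 G k) (fun _ _ => mem_const _ _))
    have hq : (fun t : ℂ => ∏ i, ((0 + t • G i) + 1).det) ∈ PolyC :=
      mem_prod _ _ _ fun k _ => mem_det _ _ fun i j => mem_add _ (lin 0 G k i j) (mem_const _ _)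
    have := polyC_cancel hp hq 0 (by simp) (fun t ht => h2 _ ht c d) 1
    simpa using this
  apply hg
  have := h4 (fun i => g i * star (x i : M4))
  convert this using 2 with i
  have h := Matrix.mem_specialUnitaryGroup_iff.mp (x i).2
  have h1 : star (x i : M4) * (x i : M4) = 1 := h.1.1
  rw [mul_assoc, h1, mul_one]

end LG

namespace LG
variable {n : ℕ}

/-- continuous functions -/
def CSub (T : Type) [TopologicalSpace T] : Subalgebra ℂ (T → ℂ) where
  carrier := {f | Continuous f}
  mul_mem' := fun {_ _} ha hb => Continuous.mul ha hb
  add_mem' := fun {_ _} ha hb => Continuous.add ha hb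
  algebraMap_mem' := fun _ => continuous_const

theorem null_of_lines {V : Type} [NormedAddCommGroup V] [NormedSpace ℝ V] [MeasurableSpace V]
    [BorelSpace V] [FiniteDimensional ℝ V] (ν : Measure V) [ν.IsAddHaarMeasure]
    (Z : Set V) (hZ : IsClosed Z) (v0 : V)
    (h : ∀ v, {t : ℝ | v0 + t • v ∈ Z}.Countable) : ν Z = 0 := by
  let Z0 : Set V := (fun v => v0 + v) ⁻¹' Z
  have e0 : ν Z0 = ν Z := measure_preimage_add ν v0 Z
  have hm : MeasurableSet {p : V × ℝ | v0 + p.2 • p.1 ∈ Z} :=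
    (hZ.preimage (by fun_prop : Continuous fun p : V × ℝ => v0 + p.2 • p.1)).measurableSet
  have h1 : ∀ᵐ v ∂ν, ∀ᵐ t : ℝ, ¬ (v0 + t • v ∈ Z) :=
    Filter.Eventually.of_forall fun v => by
      have := (h v).measure_zero (volume : Measure ℝ)
      rw [ae_iff]; simpa using this
  have h2 : ∀ᵐ t : ℝ, ∀ᵐ v ∂ν, ¬ (v0 + t • v ∈ Z) :=
    (Measure.ae_ae_comm (p := fun v t => ¬ (v0 + t • v ∈ Z)) hm.compl).mp h1
  have h3 : ∀ᵐ t : ℝ, t ≠ 0 := by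
    rw [ae_iff]; simp
  obtain ⟨t, ht, ht0⟩ := (h2.and h3).exists
  have h4 : ν ((fun v => t • v) ⁻¹' Z0) = 0 := by
    rw [ae_iff] at ht; simp only [not_not] at ht; exact ht
  rw [Measure.addHaar_preimage_smul ν ht0] at h4
  rw [← e0]
  rcases mul_eq_zero.mp h4 with h5 | h5
  · exfalso
    rw [ENNReal.ofReal_eq_zero] at h5
    have : 0 < |(t ^ Module.finrank ℝ V)⁻¹| := abs_pos.mpr (inv_ne_zero (pow_ne_zero _ ht0))
    linarith
  · exact h5

/-- parameter space -/
abbrev EPar (R : ℕ) := Fin R → Fin 4 → Fin 4 → ℂ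

/-- skew part -/
noncomputable def KN {R : ℕ} (N : EPar R) : Fin R → M4 :=
  fun i => Matrix.of (N i) - (Matrix.of (N i))ᴴ

theorem KN_skew {R : ℕ} (N : EPar R) (i : Fin R) : (KN N i)ᴴ = - KN N i := by
  simp [KN]

instance : SecondCountableTopology SU4 := by
  have : SecondCountableTopology (Matrix (Fin 4) (Fin 4) ℂ) :=
    inferInstanceAs (SecondCountableTopology (Fin 4 → Fin 4 → ℂ))
  exact Topology.IsEmbedding.subtypeVal.secondCountableTopology

instance (R : ℕ) : IsProbabilityMeasure (muSU4 R) := by unfold muSU4; infer_instance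

instance : Measure.IsMulLeftInvariant haarSU4 := by unfold haarSU4; infer_instance

instance (R : ℕ) : Measure.IsMulLeftInvariant (muSU4 R) := by unfold muSU4; infer_instance

theorem null_VV {R : ℕ} (A : Architecture n R)
    (f : MvPolynomial (QubitBasis n ⊕ QubitBasis n) ℂ) (g : Fin R → M4)
    (hg : ¬ VV' A f g) : muSU4 R {x | VV' A f (fun i => (x i : M4))} = 0 := by
  let P : (Fin R → SU4) → EPar R → Prop := fun x N =>
    ∀ c d, QQs A f c d (fun i => (x i : M4)) (KN N) = 0
  have hclosed : IsClosed {p : (Fin R → SU4) × EPar R | P p.1 p.2} := by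
    simp only [P, Set.setOf_forall]
    refine isClosed_iInter fun c => isClosed_iInter fun d => ?_
    refine isClosed_eq ?_ continuous_const
    refine mem_QQs (CSub ((Fin R → SU4) × EPar R)) A f c d (fun p i => (p.1 i : M4))
      (fun p => KN p.2) (fun k i j => ?_) (fun k i j => ?_)
    · show Continuous fun p : (Fin R → SU4) × EPar R => (p.1 k : M4) i j
      have h1 : Continuous fun p : (Fin R → SU4) × EPar R => (p.1 k : M4) :=
        continuous_subtype_val.comp ((continuous_apply k).comp continuous_fst)
      exact h1.matrix_elem i j
    · show Continuous fun p : (Fin R → SU4) × EPar R => p.2 k i j - star (p.2 k j i)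
      fun_prop
  have h1 : ∀ᵐ x ∂(muSU4 R), ∀ᵐ N ∂(Measure.addHaar : Measure (EPar R)), ¬ P x N := by
    refine Filter.Eventually.of_forall fun x => ?_
    rw [ae_iff]
    simp only [not_not]
    obtain ⟨K, hK, c, d, hne⟩ := exists_skew A f x g hg
    refine null_of_lines Measure.addHaar {N | P x N} ?_ (fun i a b => (1 / 2 : ℂ) * K i a b) fun v => ?_
    · exact hclosed.preimage (by fun_prop : Continuous fun N : EPar R => (x, N))
    · refine Set.Finite.countable ?_
      have hp := mem_QQs PolyC A f c d (fun _ i => (x i : M4)) (fun t i => K i + t • KN v i)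
        (fun _ _ _ => mem_const _ _)
        (fun k i j => mem_add _ (mem_const _ _) (mem_mul _ polyC_id (mem_const _ _)))
      have hf := polyC_finite hp 0 (by simpa using hne)
      refine (hf.preimage (f := ((↑) : ℝ → ℂ)) (Complex.ofReal_injective.injOn)).subset ?_
      intro t ht
      have := ht c d
      show QQs A f c d _ _ = 0
      rw [← this]
      congr 1
      funext i
      ext a b
      have hs : star (K i b a) = - K i a b := by
        have := congrFun (congrFun (hK i) a) b
        simpa using this
      have hs' : (starRingEnd ℂ) (K i b a) = - K i a b := hs
      simp [KN, hs']
      ring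
  have h2 : ∀ᵐ N ∂(Measure.addHaar : Measure (EPar R)), ∀ᵐ x ∂(muSU4 R), ¬ P x N :=
    (Measure.ae_ae_comm (p := fun x N => ¬ P x N) hclosed.measurableSet.compl).mp h1
  obtain ⟨N, hN⟩ := h2.exists
  rw [ae_iff] at hN
  simp only [not_not] at hN
  choose u β hβ hu using fun i => cay_SU4 (KN N i) (KN_skew N i)
  rw [← measure_preimage_mul (muSU4 R) u]
  refine measure_mono_null ?_ hN
  intro x hx
  have h3 := VV'_smul A f _ β hx
  intro c d
  have := h3 c d
  rw [QQs]
  convert this using 5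
  funext i
  rw [hu, Matrix.smul_mul]
  rfl

end LG

/-- **Linear growth of state complexity.**
Let `A` be an `n`-qubit architecture with `R = T·L` gates that is the concatenation of `T`
consecutive causal slices of `L` gates each, with `T ≤ 2^{n+1} − 2`.  Then, with unit
probability over the choice of Haar-random gates `x ∈ SU(4)^{×R}`, the exact state complexity
of the produced state `F^A(x)|0^n⟩` is at least `R/(9L) − n/3`. -/
theorem linear_growth_of_state_complexity
    (n T L : ℕ) (hn : 2 ≤ n) (hT : T ≤ 2 ^ (n + 1) - 2)
    (A : Architecture n (T * L))
    (hslices : ∀ s < T, IsCausalSlice A (s * L) ((s + 1) * L)) :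
    ∀ᵐ x ∂(muSU4 (T * L)),
      ((T * L : ℕ) : ℝ) / (9 * (L : ℝ)) - (n : ℝ) / 3 ≤
        (Cstate n ((contract A x) *ᵥ ket0 n) : ℝ) := by
  rcases Nat.eq_zero_or_pos L with rfl | hL
  · refine Filter.Eventually.of_forall fun x => ?_
    have h1 : (0 : ℝ) ≤ (Cstate n ((contract A x) *ᵥ ket0 n) : ℝ) := Nat.cast_nonneg _
    have h2 : (0 : ℝ) ≤ n := Nat.cast_nonneg _
    simp only [Nat.cast_zero, mul_zero, div_zero]
    linarith
  have hT' : T ≤ 2 ^ (n + 1) := hT.trans (Nat.sub_le _ _)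
  have key : ∀ R' : ℕ, ∀ A' : Architecture n R', 9 * R' + 2 * n + 2 < T →
      ∀ᵐ x ∂(muSU4 (T * L)), ∀ y : Fin R' → SU4,
        contract A' y *ᵥ ket0 n ≠ contract A x *ᵥ ket0 n := by
    intro R' A' hR
    obtain ⟨f, hf, g, hg⟩ := LG.exists_sep hn hT' A hslices A' hR
    have h0 := LG.null_VV A f g hg
    rw [ae_iff]
    refine measure_mono_null ?_ h0
    intro x hx
    simp only [Set.mem_setOf_eq, not_forall, not_not, ne_eq] at hx
    obtain ⟨y, hy⟩ := hx
    intro c d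
    exact hf _ (LG.orbL_cone LG.W0_cone _ (LG.PA_mem A x A' y hy) c d)
  have key2 : ∀ᵐ x ∂(muSU4 (T * L)), ∀ R' : ℕ, ∀ A' : Architecture n R', 9 * R' + 2 * n + 2 < T →
      ∀ y : Fin R' → SU4, contract A' y *ᵥ ket0 n ≠ contract A x *ᵥ ket0 n := by
    rw [ae_all_iff]
    intro R'
    have : Countable (Architecture n R') :=
      inferInstanceAs (Countable (Fin R' → {p : Fin n × Fin n // p.1 ≠ p.2}))
    rw [ae_all_iff]
    intro A'
    by_cases hR : 9 * R' + 2 * n + 2 < T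
    · filter_upwards [key R' A' hR] with x hx _ using hx
    · exact Filter.Eventually.of_forall fun x h => absurd h hR
  filter_upwards [key2] with x hx
  have hne : {R | ∃ A' : Architecture n R, ∃ y : Fin R → SU4,
      (contract A' y) *ᵥ ket0 n = contract A x *ᵥ ket0 n}.Nonempty := ⟨T * L, A, x, rfl⟩
  obtain ⟨A', y, hy⟩ := Nat.sInf_mem hne
  change Fin (Cstate n (contract A x *ᵥ ket0 n)) → SU4 at y
  have hge : T ≤ 9 * Cstate n (contract A x *ᵥ ket0 n) + 2 * n + 2 := by
    by_contra hlt
    exact hx _ A' (not_le.mp hlt) y hy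
  have hge' : T ≤ 9 * Cstate n (contract A x *ᵥ ket0 n) + 3 * n := by omega
  have hge2 : (T : ℝ) ≤ 9 * (Cstate n (contract A x *ᵥ ket0 n) : ℝ) + 3 * n := by
    exact_mod_cast hge'
  have hL' : (0 : ℝ) < L := by exact_mod_cast hL
  have : ((T * L : ℕ) : ℝ) / (9 * (L : ℝ)) = T / 9 := by
    push_cast
    field_simp
  rw [this]
  linarith
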